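/- Let n ≥ 2 and k ≥ 1. Then the group RTM(n,k) of Turing machines contains a distortion element; indeed there exist a finite set F ⊆ RTM(n,k) and an element f ∈ ⟨F⟩ of infinite order such that for some constant K > 0, ‖f^m‖_F ≤ K·(log m)⁴ for all m ≥ 2. -/

import Mathlib

/-- The word norm of `g` with respect to the generating set `F`:
the least `n` such that `g` is a product of `n` elements of `F ∪ F⁻¹`. -/
noncomputable def wordNorm {G : Type*} [Group G] (F : Set G) (g : G) : ℕ :=
  sInf {n : ℕ | ∃ w : List G, w.length = n ∧ (∀ x ∈ w, x ∈ F ∨ x⁻¹ ∈ F) ∧ w.prod = g}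

/-- Configurations for the group of Turing machines: a tape over `Fin n` together with a
configuration over the alphabet `{0,…,k}` = `Fin (k+1)`. -/
abbrev RTMConf (n k : ℕ) : Type := (ℤ → Fin n) × (ℤ → Fin (k + 1))

/-- The space `Y_n × X_k`: the second component has at most one nonzero coordinate. -/
def RTMSpace (n k : ℕ) : Set (RTMConf n k) :=
  {p | ∀ i j : ℤ, p.2 i ≠ 0 → p.2 j ≠ 0 → i = j}

/-- The diagonal shift on `Y_n × X_k`. -/
def RTMshift (n k : ℕ) : RTMConf n k → RTMConf n k :=
  fun p => (fun i => p.1 (i + 1), fun i => p.2 (i + 1))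

/-- The group of Turing machines `RTM(n,k)`: permutations of `Y_n × X_k` which are
homeomorphisms, commute with the shift, and restrict to the identity on `Y_n × {0^ℤ}`. -/
def RTMGroup (n k : ℕ) : Set (Equiv.Perm (RTMSpace n k)) :=
  {f | Continuous f ∧ Continuous f.symm ∧
    (∀ p q : RTMSpace n k, (q : RTMConf n k) = RTMshift n k (p : RTMConf n k) →
      ((f q : RTMSpace n k) : RTMConf n k) = RTMshift n k ((f p : RTMSpace n k) : RTMConf n k)) ∧
    (∀ p : RTMSpace n k, (p : RTMConf n k).2 = (fun _ => 0) → f p = p)}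

/-- `g` is a product of at most `ℓ` elements of `S ∪ S⁻¹`. -/
def HasWord {G : Type*} [Group G] (S : Set G) (ℓ : ℕ) (g : G) : Prop :=
  ∃ w : List G, w.length ≤ ℓ ∧ (∀ x ∈ w, x ∈ S ∨ x⁻¹ ∈ S) ∧ w.prod = g

namespace HasWord

variable {G H : Type*} [Group G] [Group H] {S : Set G} {k l : ℕ} {g h : G}

lemma mono (hg : HasWord S k g) (hkl : k ≤ l) : HasWord S l g := by
  obtain ⟨w, h1, h2, h3⟩ := hg
  exact ⟨w, h1.trans hkl, h2, h3⟩

lemma one : HasWord S 0 (1 : G) := ⟨[], by simp⟩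

lemma of_mem (hg : g ∈ S) : HasWord S 1 g := ⟨[g], by simp [hg]⟩

lemma mul (hg : HasWord S k g) (hh : HasWord S l h) : HasWord S (k + l) (g * h) := by
  obtain ⟨w, h1, h2, h3⟩ := hg
  obtain ⟨w', h1', h2', h3'⟩ := hh
  refine ⟨w ++ w', by simpa using add_le_add h1 h1', ?_, by simp [h3, h3']⟩
  intro x hx
  rcases List.mem_append.1 hx with hx | hx
  exacts [h2 x hx, h2' x hx]

lemma inv (hg : HasWord S k g) : HasWord S k g⁻¹ := by
  obtain ⟨w, h1, h2, h3⟩ := hg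
  refine ⟨(w.map (·⁻¹)).reverse, by simpa using h1, ?_, by rw [← h3, List.prod_inv_reverse]⟩
  intro x hx
  simp only [List.mem_reverse, List.mem_map] at hx
  obtain ⟨y, hy, rfl⟩ := hx
  simpa using (h2 y hy).symm

lemma pow (hg : HasWord S k g) (n : ℕ) : HasWord S (n * k) (g ^ n) := by
  induction n with
  | zero => simpa using one
  | succ n ih => rw [pow_succ, Nat.succ_mul]; exact ih.mul hg

lemma map (φ : G →* H) (hg : HasWord S k g) : HasWord (φ '' S) k (φ g) := by
  obtain ⟨w, h1, h2, h3⟩ := hg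
  refine ⟨w.map φ, by simpa using h1, ?_, by rw [← h3, map_list_prod]⟩
  intro x hx
  obtain ⟨y, hy, rfl⟩ := List.mem_map.1 hx
  rcases h2 y hy with h | h
  · exact Or.inl ⟨y, h, rfl⟩
  · exact Or.inr ⟨y⁻¹, h, map_inv φ y⟩

lemma mem_closure (hg : HasWord S k g) : g ∈ Subgroup.closure S := by
  obtain ⟨w, -, h2, rfl⟩ := hg
  refine Subgroup.list_prod_mem _ fun x hx => ?_
  rcases h2 x hx with h | h
  · exact Subgroup.subset_closure h
  · simpa using inv_mem (Subgroup.subset_closure h)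

lemma wordNorm_le (hg : HasWord S k g) : wordNorm S g ≤ k := by
  obtain ⟨w, h1, h2, h3⟩ := hg
  exact (Nat.sInf_le (by exact ⟨w, rfl, h2, h3⟩)).trans h1

end HasWord

namespace Tape

/-- Prepend a letter to a stream. -/
def cons {B : Type*} (a : B) (s : ℕ → B) : ℕ → B
  | 0 => a
  | i + 1 => s i

/-- Drop the first letter of a stream. -/
def tail {B : Type*} (s : ℕ → B) : ℕ → B := fun i => s (i + 1)

section Stream
variable {B : Type*} (a : B) (s : ℕ → B)

@[simp] lemma cons_zero : cons a s 0 = a := rfl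
@[simp] lemma cons_succ (i : ℕ) : cons a s (i + 1) = s i := rfl
@[simp] lemma tail_cons : tail (cons a s) = s := rfl
@[simp] lemma cons_tail : cons (s 0) (tail s) = s := by funext i; cases i <;> rfl
lemma exists_cons (s : ℕ → B) : ∃ a t, s = cons a t := ⟨s 0, tail s, (cons_tail s).symm⟩
end Stream

/-- Configurations of a machine with control `C`: the control, the tape to the left of the head,
the tape to the right of the head, and the position of the head. -/
abbrev Config (C B : Type*) := C × (ℕ → B) × (ℕ → B) × ℤ

variable {C B : Type*} (b : ℤ)

/-- Apply a permutation to the control and the two letters next to the head. -/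
def loc (τ : Equiv.Perm (C × B × B)) : Equiv.Perm (Config C B) where
  toFun ω :=
    let r := τ (ω.1, ω.2.1 0, ω.2.2.1 0)
    (r.1, cons r.2.1 (tail ω.2.1), cons r.2.2 (tail ω.2.2.1), ω.2.2.2)
  invFun ω :=
    let r := τ.symm (ω.1, ω.2.1 0, ω.2.2.1 0)
    (r.1, cons r.2.1 (tail ω.2.1), cons r.2.2 (tail ω.2.2.1), ω.2.2.2)
  left_inv ω := by simp
  right_inv ω := by simp

lemma loc_apply (τ : Equiv.Perm (C × B × B)) (c : C) (l r : B) (L R : ℕ → B) (p : ℤ) :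
    loc τ (c, cons l L, cons r R, p) =
      ((τ (c, l, r)).1, cons (τ (c, l, r)).2.1 L, cons (τ (c, l, r)).2.2 R, p) := rfl

/-- Move the head to the right if the control satisfies `φ`. -/
def move (φ : C → Bool) : Equiv.Perm (Config C B) where
  toFun ω := if φ ω.1 then (ω.1, cons (ω.2.2.1 0) ω.2.1, tail ω.2.2.1, ω.2.2.2 + b) else ω
  invFun ω := if φ ω.1 then (ω.1, tail ω.2.1, cons (ω.2.1 0) ω.2.2.1, ω.2.2.2 - b) else ω
  left_inv ω := by by_cases h : φ ω.1 <;> simp [h]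
  right_inv ω := by by_cases h : φ ω.1 <;> simp [h]

lemma move_apply_true {φ : C → Bool} {c : C} (h : φ c = true) (r : B) (L R : ℕ → B) (p : ℤ) :
    move b φ (c, L, cons r R, p) = (c, cons r L, R, p + b) := by
  simp [move, h]

lemma move_apply_false {φ : C → Bool} {c : C} (h : φ c = false) (L R : ℕ → B) (p : ℤ) :
    move b φ (c, L, R, p) = (c, L, R, p) := by
  simp [move, h]

lemma move_symm_apply_true {φ : C → Bool} {c : C} (h : φ c = true) (r : B) (L R : ℕ → B) (p : ℤ) :
    (move b φ)⁻¹ (c, cons r L, R, p) = (c, L, cons r R, p - b) := by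
  rw [Equiv.Perm.inv_eq_iff_eq, move_apply_true b h, sub_add_cancel]

lemma move_symm_apply_false {φ : C → Bool} {c : C} (h : φ c = false) (L R : ℕ → B) (p : ℤ) :
    (move b φ)⁻¹ (c, L, R, p) = (c, L, R, p) := by
  rw [Equiv.Perm.inv_eq_iff_eq, move_apply_false b h]

/-- The generators. -/
def gens (C B : Type*) (b : ℤ) : Set (Equiv.Perm (Config C B)) :=
  Set.range loc ∪ Set.range (move b)

/-- Insert a letter directly to the right of the head. -/
def insertLetter : Config C B × B ≃ Config C B where
  toFun x := (x.1.1, x.1.2.1, cons x.2 x.1.2.2.1, x.1.2.2.2)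
  invFun ω := ((ω.1, ω.2.1, tail ω.2.2.1, ω.2.2.2), ω.2.2.1 0)
  left_inv _ := rfl
  right_inv ω := by simp

lemma insertLetter_apply (c : C) (L R : ℕ → B) (p : ℤ) (d : B) :
    insertLetter ((c, L, R, p), d) = (c, L, cons d R, p) := rfl

/-- The permutation which acts as `g` while ignoring the letter to the right of the head. -/
def fat : Equiv.Perm (Config C B) →* Equiv.Perm (Config C B) where
  toFun g := insertLetter.permCongr (g.prodCongr (1 : Equiv.Perm B))
  map_one' := by ext1 ω; simp
  map_mul' g h := by ext1 ω; simp [Prod.map]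

lemma fat_insertLetter (g : Equiv.Perm (Config C B)) (ω : Config C B) (d : B) :
    fat g (insertLetter (ω, d)) = insertLetter (g ω, d) := by
  simp [fat]

lemma ext_insertLetter {g h : Equiv.Perm (Config C B)}
    (H : ∀ ω d, g (insertLetter (ω, d)) = h (insertLetter (ω, d))) : g = h := by
  ext1 ω
  obtain ⟨⟨ω, d⟩, rfl⟩ := insertLetter.surjective ω
  exact H ω d

lemma fat_injective [Nonempty B] :
    Function.Injective (fat : Equiv.Perm (Config C B) →* Equiv.Perm (Config C B)) := by
  intro g h hgh
  ext1 ω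
  obtain ⟨d⟩ := ‹Nonempty B›
  have := fat_insertLetter g ω d
  rw [hgh, fat_insertLetter] at this
  simpa using (insertLetter.injective this).symm

/-- The permutation of the control and the adjacent letters exchanging the letters if `φ`. -/
def exchange (φ : C → Bool) : Equiv.Perm (C × B × B) where
  toFun x := if φ x.1 then (x.1, x.2.2, x.2.1) else x
  invFun x := if φ x.1 then (x.1, x.2.2, x.2.1) else x
  left_inv x := by by_cases h : φ x.1 <;> simp [h]
  right_inv x := by by_cases h : φ x.1 <;> simp [h]

/-- Exchange the two letters to the right of the head if the control satisfies `φ`. -/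
def swap (φ : C → Bool) : Equiv.Perm (Config C B) :=
  (move b φ)⁻¹ * loc (exchange φ) * move b φ

lemma swap_apply_true {φ : C → Bool} {c : C} (h : φ c = true) (r s : B) (L R : ℕ → B) (p : ℤ) :
    swap b φ (c, L, cons r (cons s R), p) = (c, L, cons s (cons r R), p) := by
  simp only [swap, Equiv.Perm.mul_apply, move_apply_true b h, loc_apply]
  simp [exchange, h, move_symm_apply_true b h]

lemma swap_apply_false {φ : C → Bool} {c : C} (h : φ c = false) (L R : ℕ → B) (p : ℤ) :
    swap b φ (c, L, R, p) = (c, L, R, p) := by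
  obtain ⟨l, L, rfl⟩ := exists_cons L
  obtain ⟨r, R, rfl⟩ := exists_cons R
  simp only [swap, Equiv.Perm.mul_apply, move_apply_false b h, loc_apply]
  simp [exchange, h, move_symm_apply_false b h]

/-- The unconditional head movement. -/
abbrev mv (C B : Type*) (b : ℤ) : Equiv.Perm (Config C B) := move b fun _ => true

/-- The unconditional exchange of the two letters to the right of the head. -/
abbrev sw (C B : Type*) (b : ℤ) : Equiv.Perm (Config C B) := swap b fun _ => true

lemma sw_mul_self : sw C B b * sw C B b = 1 := by
  ext1 ⟨c, L, R, p⟩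
  obtain ⟨r, R, rfl⟩ := exists_cons R
  obtain ⟨s, R, rfl⟩ := exists_cons R
  simp [sw, swap_apply_true]

lemma fat_move (φ : C → Bool) : fat (move b φ : Equiv.Perm (Config C B)) = move b φ * swap b φ := by
  refine ext_insertLetter fun ⟨c, L, R, p⟩ d => ?_
  obtain ⟨r, R, rfl⟩ := exists_cons R
  rw [fat_insertLetter, Equiv.Perm.mul_apply, insertLetter_apply c]
  cases h : φ c
  · rw [move_apply_false b h, swap_apply_false b h, move_apply_false b h, insertLetter_apply]
  · rw [move_apply_true b h, swap_apply_true b h, move_apply_true b h, insertLetter_apply]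

lemma fat_loc (τ : Equiv.Perm (C × B × B)) : fat (loc τ) = sw C B b * loc τ * sw C B b := by
  refine ext_insertLetter fun ⟨c, L, R, p⟩ d => ?_
  obtain ⟨l, L, rfl⟩ := exists_cons L
  obtain ⟨r, R, rfl⟩ := exists_cons R
  rw [fat_insertLetter, Equiv.Perm.mul_apply, Equiv.Perm.mul_apply, insertLetter_apply c,
    swap_apply_true b rfl, loc_apply, loc_apply, swap_apply_true b rfl, insertLetter_apply]

lemma fat_swap (φ : C → Bool) :
    fat (swap b φ : Equiv.Perm (Config C B)) = (mv C B b)⁻¹ * swap b φ * mv C B b := by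
  refine ext_insertLetter fun ⟨c, L, R, p⟩ d => ?_
  obtain ⟨r, R, rfl⟩ := exists_cons R
  obtain ⟨s, R, rfl⟩ := exists_cons R
  rw [fat_insertLetter, Equiv.Perm.mul_apply, Equiv.Perm.mul_apply, insertLetter_apply c,
    move_apply_true b rfl]
  cases h : φ c
  · rw [swap_apply_false b h, swap_apply_false b h, move_symm_apply_true b rfl, insertLetter_apply,
      add_sub_cancel_right]
  · rw [swap_apply_true b h, swap_apply_true b h, move_symm_apply_true b rfl, insertLetter_apply,
      add_sub_cancel_right]

lemma commute_sw_fat_fat (g : Equiv.Perm (Config C B)) : Commute (sw C B b) (fat (fat g)) := by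
  refine ext_insertLetter fun ω d => ?_
  obtain ⟨⟨ω, e⟩, rfl⟩ := insertLetter.surjective ω
  have key (ω : Config C B) (d e : B) :
      sw C B b (insertLetter (insertLetter (ω, e), d)) = insertLetter (insertLetter (ω, d), e) :=
    swap_apply_true b rfl d e ω.2.1 ω.2.2.1 ω.2.2.2
  rw [Equiv.Perm.mul_apply, Equiv.Perm.mul_apply, fat_insertLetter, fat_insertLetter, key, key,
    fat_insertLetter,
    fat_insertLetter]

lemma fat_iterate_swap (φ : C → Bool) (k : ℕ) :
    fat^[k] (swap b φ : Equiv.Perm (Config C B)) = (mv C B b)⁻¹ ^ k * swap b φ * mv C B b ^ k := by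
  have key : ∀ k, fat^[k + 1] (swap b φ : Equiv.Perm (Config C B)) =
      (mv C B b)⁻¹ * fat^[k] (swap b φ) * mv C B b := by
    intro k
    induction k with
    | zero => simpa using fat_swap b φ
    | succ k ih =>
      have hc : fat^[k + 2] (swap b φ : Equiv.Perm (Config C B)) =
          fat (fat (fat^[k] (swap b φ))) := by
        rw [Function.iterate_succ_apply', Function.iterate_succ_apply']
      have h := (commute_sw_fat_fat b (fat^[k] (swap b φ : Equiv.Perm (Config C B)))).eq
      rw [← hc] at h
      have h2 := congrArg fat ih
      rw [map_mul, map_mul, map_inv, fat_move, ← Function.iterate_succ_apply' fat,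
        ← Function.iterate_succ_apply' fat] at h2
      calc fat^[k + 2] (swap b φ)
          = sw C B b * fat^[k + 2] (swap b φ) * (sw C B b)⁻¹ := by rw [h, mul_inv_cancel_right]
        _ = _ := by rw [h2]; group
  induction k with
  | zero => simp
  | succ k ih => rw [key, ih, pow_succ', pow_succ]; simp only [mul_assoc]

lemma fat_iterate_move (φ : C → Bool) (k : ℕ) :
    fat^[k] (move b φ : Equiv.Perm (Config C B)) =
      move b φ * (swap b φ * (mv C B b)⁻¹) ^ k * mv C B b ^ k := by
  induction k with
  | zero => simp
  | succ k ih =>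
    rw [Function.iterate_succ_apply, fat_move, iterate_map_mul, ih, fat_iterate_swap, pow_succ,
      pow_succ' (mv C B b)]
    group

lemma fat_iterate_loc (τ : Equiv.Perm (C × B × B)) (k : ℕ) :
    fat^[k] (loc τ) =
      (mv C B b)⁻¹ ^ k * (mv C B b * sw C B b) ^ k * loc τ *
        ((mv C B b)⁻¹ ^ k * (mv C B b * sw C B b) ^ k)⁻¹ := by
  have hs : (sw C B b)⁻¹ = sw C B b := inv_eq_of_mul_eq_one_left (sw_mul_self b)
  induction k with
  | zero => simp
  | succ k ih =>
    have e : (mv C B b)⁻¹ ^ (k + 1) * (mv C B b * sw C B b) ^ (k + 1) =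
        fat^[k] (sw C B b) * ((mv C B b)⁻¹ ^ k * (mv C B b * sw C B b) ^ k) := by
      rw [fat_iterate_swap, pow_succ, pow_succ' (_ * _), inv_pow]
      simp only [mul_assoc, inv_mul_cancel_left, mul_inv_cancel_left]
    have e' : fat^[k] (sw C B b) = (fat^[k] (sw C B b))⁻¹ := by
      rw [← iterate_map_inv, hs]
    rw [Function.iterate_succ_apply, fat_loc b, iterate_map_mul, iterate_map_mul, ih, e,
      mul_inv_rev (fat^[k] (sw C B b)), ← e']
    simp only [mul_assoc]

lemma hasWord_swap (φ : C → Bool) :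
    HasWord (gens C B b) 3 (swap b φ : Equiv.Perm (Config C B)) := by
  have h : HasWord (gens C B b) 1 (move b φ) := .of_mem (Or.inr ⟨φ, rfl⟩)
  exact (h.inv.mul (.of_mem (Or.inl ⟨_, rfl⟩))).mul h

lemma hasWord_fat_iterate_of_mem_gens {g : Equiv.Perm (Config C B)} (hg : g ∈ gens C B b) (k : ℕ) :
    HasWord (gens C B b) (10 * (k + 1)) (fat^[k] g) := by
  have hm : HasWord (gens C B b) 1 (mv C B b) := .of_mem (Or.inr ⟨_, rfl⟩)
  have hg' := HasWord.of_mem hg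
  obtain ⟨τ, rfl⟩ | ⟨φ, rfl⟩ := hg
  · rw [fat_iterate_loc b]
    have h := (hm.inv.pow k).mul ((hm.mul (hasWord_swap b fun _ => true)).pow k)
    exact ((h.mul hg').mul h.inv).mono (by omega)
  · rw [fat_iterate_move]
    exact ((hg'.mul (((hasWord_swap b φ).mul hm.inv).pow k)).mul (hm.pow k)).mono (by omega)

lemma hasWord_fat_iterate {g : Equiv.Perm (Config C B)} {l : ℕ} (hg : HasWord (gens C B b) l g)
    (k : ℕ) : HasWord (gens C B b) (l * (10 * (k + 1))) (fat^[k] g) := by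
  obtain ⟨w, h1, h2, rfl⟩ := hg
  refine HasWord.mono ?_ (Nat.mul_le_mul_right _ h1)
  clear h1
  induction w with
  | nil => simpa [iterate_map_one] using HasWord.one
  | cons x w ih =>
    rw [List.prod_cons, iterate_map_mul, List.length_cons, add_comm, add_mul, one_mul]
    refine HasWord.mul ?_ (ih fun y hy => h2 y (List.mem_cons_of_mem _ hy))
    rcases h2 x List.mem_cons_self with h | h
    · exact hasWord_fat_iterate_of_mem_gens b h k
    · have := (hasWord_fat_iterate_of_mem_gens b h k).inv
      rwa [← iterate_map_inv, inv_inv] at this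

/-- If `f ^ m` is conjugate to `fat f`, then the powers of `f` have short words. -/
lemma hasWord_fat_iterate_pow {f ψ : Equiv.Perm (Config C B)} {m l : ℕ} (hm : 0 < m)
    (hf : HasWord (gens C B b) l f) (hψ : HasWord (gens C B b) l ψ)
    (h : f ^ m = ψ * fat f * ψ⁻¹) (K : ℕ) :
    ∀ j M : ℕ, M < m ^ K →
      HasWord (gens C B b) (K * ((m + 2) * (l * (10 * (j + K + 1))))) ((fat^[j] f) ^ M) := by
  induction K with
  | zero =>
    intro j M hM
    obtain rfl : M = 0 := by simpa using hM
    simpa using HasWord.one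
  | succ K ih =>
    intro j M hM
    have hq : M / m < m ^ K := by
      rw [Nat.div_lt_iff_lt_mul hm, ← pow_succ]; exact hM
    have e : (fat^[j] f) ^ M =
        (fat^[j] f) ^ (M % m) * (fat^[j] ψ * (fat^[j + 1] f) ^ (M / m) * (fat^[j] ψ)⁻¹) := by
      conv_lhs => rw [← Nat.mod_add_div M m, pow_add, pow_mul]
      rw [← iterate_map_pow fat j f m, h, iterate_map_mul, iterate_map_mul, iterate_map_inv,
        Function.iterate_succ_apply, conj_pow]
    rw [e]
    have h1 := (hasWord_fat_iterate b hf j).pow (M % m)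
    have h2 := hasWord_fat_iterate b hψ j
    refine (h1.mul ((h2.mul (ih (j + 1) _ hq)).mul h2.inv)).mono ?_
    have hr : M % m ≤ m := (Nat.mod_lt _ hm).le
    have h3 : M % m * (l * (10 * (j + 1))) ≤ m * (l * (10 * (j + 1))) := Nat.mul_le_mul_right _ hr
    have h4 : l * (10 * (j + 1)) ≤ l * (10 * (j + (K + 1) + 1)) := by gcongr; omega
    have h5 : m * (l * (10 * (j + 1))) ≤ m * (l * (10 * (j + (K + 1) + 1))) := by gcongr
    have h6 : j + 1 + K + 1 = j + (K + 1) + 1 := by omega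
    rw [h6]
    nlinarith

end Tape

namespace CounterMachine

/-- The state after reading `v` in state `q`. -/
def nextState (κ : ℤ) (q : Bool) (v : ℤ) : Bool :=
  if q then decide (2 ≤ v) else decide (κ ≤ v)

/-- The symbol written when reading `v` in state `q`. -/
def written (κ : ℤ) (q : Bool) (v : ℤ) : ℤ :=
  if q then
    if v = 0 then κ + 1 else if v = 1 then 0 else if v ≤ κ then v - 1 else 0
  else
    if v < κ then v + 1 else v

/-- Whether the head turns around when reading `v` in state `q`. -/
def turns (q : Bool) (v : ℤ) : Bool :=
  if q then decide (2 ≤ v) else true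

/-- The time spent on reading `v` in state `q`. -/
def duration (κ : ℤ) (q : Bool) (v : ℤ) : ℤ :=
  if q then
    if v ≤ 1 then κ * (κ + 1) else if v ≤ κ then (κ + 2) * (κ + 1 - v) else κ + 2
  else
    if v < κ then κ * (κ + 2) * (κ - v) else κ

/-- The symbol inserted behind the head which encodes the simulated state. -/
def marker (κ : ℤ) (q : Bool) : ℤ := if q then κ + 1 else 0

/-- The data of the simulated machine decoded from a window. -/
structure Decoded where
  state : Bool
  symbol : ℤ
  turned : Bool
  time : ℤ

def remaining (κ u v : ℤ) : ℤ :=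
  (κ + 2) * ((2 * v - 1) * (κ + 1) - 2 * v - u * v + u + 1) - κ

/-- Decoding a window: state `q`, symbol `u` behind the head and symbol `v` in front of it. -/
def decodeWindow (κ : ℤ) (q : Bool) (u v : ℤ) : Decoded :=
  if q then
    if v = 0 then
      if u = 0 then
        ⟨true, κ + 1, true, (κ + 2) * (κ + 2) - κ * (κ + 1)⟩
      else if u < κ then
        ⟨true, u + 1, true, (κ + 2) * duration κ true (u + 1) - κ * (κ + 1)⟩
      else ⟨false, u, true, (κ + 2) * κ - κ * (κ + 1)⟩
    else if u = 0 then
      ⟨true, v, false, (if v < κ then duration κ false v + κ + duration κ true (v + 1) else κ)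
        + (κ + 2)⟩
    else if v = κ + 1 then
      ⟨true, u, true, if u < κ then duration κ false u + κ + duration κ true (u + 1) else κ⟩
    else if u = κ + 1 then ⟨true, v - 1, false, duration κ false (v - 1) + κ⟩
    else if v ≤ u then
      ⟨false, u - v, true, (κ + 2) * duration κ false (u - v) - remaining κ u v⟩
    else
      ⟨false, v - u - 1, false,
        (κ + 2) * duration κ false (v - u - 1) - remaining κ (v - 1) u - duration κ true v⟩
  else
    if u = 0 then ⟨false, v, false, 0⟩
    else if u = κ + 1 then ⟨true, v, false, 0⟩
    else if v = κ + 1 then ⟨true, u - 1, true, duration κ false (u - 1)⟩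
    else if u ≤ v then ⟨false, v - u, false, κ * (κ + 2) * u * (2 * κ - v + 1)⟩
    else ⟨false, u - 1 - v, true, κ * (κ + 2) * (v * (2 * κ - u + 2) + (κ + 1 - u))⟩

lemma duration_pos {κ : ℤ} (hκ : 2 ≤ κ) (q : Bool) (v : ℤ) :
    0 < duration κ q v := by
  unfold duration
  split_ifs <;> first | positivity | (apply mul_pos <;> first | positivity | linarith)

lemma duration_le {κ : ℤ} (hκ : 2 ≤ κ) (q : Bool) {v : ℤ} (h0 : 0 ≤ v) :
    duration κ q v ≤ κ * (κ + 2) * κ := by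
  unfold duration
  have h2 : 4 ≤ κ * κ := by nlinarith
  have h3 : 8 ≤ κ * κ * κ := by nlinarith
  have h4 : 2 * (κ * κ) ≤ κ * κ * κ := by nlinarith
  split_ifs <;> nlinarith [mul_nonneg (by linarith : 0 ≤ κ) h0,
    mul_nonneg (mul_nonneg (by linarith : 0 ≤ κ) (by linarith : 0 ≤ κ + 2)) h0]

lemma written_nonneg {κ : ℤ} (hκ : 2 ≤ κ) (q : Bool) {v : ℤ} (h0 : 0 ≤ v) :
    0 ≤ written κ q v := by
  unfold written; split_ifs <;> omega

lemma written_le {κ : ℤ} (hκ : 2 ≤ κ) (q : Bool) {v : ℤ} (h1 : v ≤ κ + 1) :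
    written κ q v ≤ κ + 1 := by
  unfold written; split_ifs <;> omega

lemma step_injective {κ : ℤ} (hκ : 2 ≤ κ) {q q' : Bool} {v v' : ℤ}
    (h0 : 0 ≤ v) (h1 : v ≤ κ + 1) (h0' : 0 ≤ v') (h1' : v' ≤ κ + 1)
    (hs : nextState κ q v = nextState κ q' v') (hw : written κ q v = written κ q' v') :
    q = q' ∧ v = v' := by
  unfold nextState at hs; unfold written at hw
  cases q <;> cases q' <;> simp at hs hw ⊢ <;> split_ifs at hw <;> grind

lemma turns_eq_false {q : Bool} {v : ℤ} (h : turns q v = false) : q = true ∧ v ≤ 1 := by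
  unfold turns at h; cases q <;> simp at h ⊢; omega

section Specifications

variable {κ u v : ℤ}

lemma duration_false_of_lt (h : v < κ) : duration κ false v = κ * (κ + 2) * (κ - v) := by
  simp [duration, h]

lemma duration_false_of_ge (h : κ ≤ v) : duration κ false v = κ := by
  simp [duration, h]

lemma duration_true_of_le_one (h : v ≤ 1) : duration κ true v = κ * (κ + 1) := by
  simp [duration, h]

lemma duration_true_of_le (h : 2 ≤ v) (h' : v ≤ κ) :
    duration κ true v = (κ + 2) * (κ + 1 - v) := by
  simp [duration, h', show ¬v ≤ 1 by omega]

lemma duration_true_of_gt (h : 2 ≤ v) (h' : κ < v) : duration κ true v = κ + 2 := by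
  simp [duration, show ¬v ≤ 1 by omega, show ¬v ≤ κ by omega]

lemma decodeWindow_false_zero (h : u = 0) : decodeWindow κ false u v = ⟨false, v, false, 0⟩ := by
  simp [decodeWindow, h]

lemma decodeWindow_false_top (h : u ≠ 0) (h' : u = κ + 1) :
    decodeWindow κ false u v = ⟨true, v, false, 0⟩ := by
  simp only [decodeWindow, if_neg h, if_pos h', Bool.false_eq_true, if_false]

lemma decodeWindow_false_front_top (h : u ≠ 0) (h' : u ≠ κ + 1) (hv : v = κ + 1) :
    decodeWindow κ false u v = ⟨true, u - 1, true, duration κ false (u - 1)⟩ := by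
  simp only [decodeWindow, if_neg h, if_neg h', if_pos hv, Bool.false_eq_true, if_false]

lemma decodeWindow_false_of_le (h : u ≠ 0) (h' : u ≠ κ + 1) (hv : v ≠ κ + 1) (huv : u ≤ v) :
    decodeWindow κ false u v =
      ⟨false, v - u, false, κ * (κ + 2) * u * (2 * κ - v + 1)⟩ := by
  simp only [decodeWindow, if_neg h, if_neg h', if_neg hv, if_pos huv, Bool.false_eq_true,
    if_false]

lemma decodeWindow_false_of_gt (h : u ≠ 0) (h' : u ≠ κ + 1) (hv : v ≠ κ + 1) (huv : ¬u ≤ v) :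
    decodeWindow κ false u v =
      ⟨false, u - 1 - v, true, κ * (κ + 2) * (v * (2 * κ - u + 2) + (κ + 1 - u))⟩ := by
  simp only [decodeWindow, if_neg h, if_neg h', if_neg hv, if_neg huv, Bool.false_eq_true,
    if_false]

lemma decodeWindow_true_zero_zero (hv : v = 0) (hu : u = 0) :
    decodeWindow κ true u v = ⟨true, κ + 1, true, (κ + 2) * (κ + 2) - κ * (κ + 1)⟩ := by
  simp only [decodeWindow, if_pos hv, if_pos hu, if_true]

lemma decodeWindow_true_zero_of_lt (hv : v = 0) (hu : u ≠ 0) (h : u < κ) :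
    decodeWindow κ true u v =
      ⟨true, u + 1, true, (κ + 2) * duration κ true (u + 1) - κ * (κ + 1)⟩ := by
  simp only [decodeWindow, if_pos hv, if_neg hu, if_pos h, if_true]

lemma decodeWindow_true_zero_of_ge (hv : v = 0) (hu : u ≠ 0) (h : ¬u < κ) :
    decodeWindow κ true u v = ⟨false, u, true, (κ + 2) * κ - κ * (κ + 1)⟩ := by
  simp only [decodeWindow, if_pos hv, if_neg hu, if_neg h, if_true]

lemma decodeWindow_true_behind_zero_of_lt (hv : v ≠ 0) (hu : u = 0) (h : v < κ) :
    decodeWindow κ true u v =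
      ⟨true, v, false, duration κ false v + κ + duration κ true (v + 1) + (κ + 2)⟩ := by
  simp only [decodeWindow, if_neg hv, if_pos hu, if_pos h, if_true]

lemma decodeWindow_true_behind_zero_of_ge (hv : v ≠ 0) (hu : u = 0) (h : ¬v < κ) :
    decodeWindow κ true u v = ⟨true, v, false, κ + (κ + 2)⟩ := by
  simp only [decodeWindow, if_neg hv, if_pos hu, if_neg h, if_true]

lemma decodeWindow_true_front_top_of_lt (hv : v ≠ 0) (hu : u ≠ 0) (hv' : v = κ + 1) (h : u < κ) :
    decodeWindow κ true u v =
      ⟨true, u, true, duration κ false u + κ + duration κ true (u + 1)⟩ := by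
  simp only [decodeWindow, if_neg hv, if_neg hu, if_pos hv', if_pos h, if_true]

lemma decodeWindow_true_front_top_of_ge (hv : v ≠ 0) (hu : u ≠ 0) (hv' : v = κ + 1)
    (h : ¬u < κ) : decodeWindow κ true u v = ⟨true, u, true, κ⟩ := by
  simp only [decodeWindow, if_neg hv, if_neg hu, if_pos hv', if_neg h, if_true]

lemma decodeWindow_true_top (hv : v ≠ 0) (hu : u ≠ 0) (hv' : v ≠ κ + 1) (hu' : u = κ + 1) :
    decodeWindow κ true u v = ⟨true, v - 1, false, duration κ false (v - 1) + κ⟩ := by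
  simp only [decodeWindow, if_neg hv, if_neg hu, if_neg hv', if_pos hu', if_true]

lemma decodeWindow_true_of_le (hv : v ≠ 0) (hu : u ≠ 0) (hv' : v ≠ κ + 1) (hu' : u ≠ κ + 1)
    (h : v ≤ u) :
    decodeWindow κ true u v =
      ⟨false, u - v, true, (κ + 2) * duration κ false (u - v) - remaining κ u v⟩ := by
  simp only [decodeWindow, if_neg hv, if_neg hu, if_neg hv', if_neg hu', if_pos h, if_true]

lemma decodeWindow_true_of_gt (hv : v ≠ 0) (hu : u ≠ 0) (hv' : v ≠ κ + 1) (hu' : u ≠ κ + 1)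
    (h : ¬v ≤ u) :
    decodeWindow κ true u v = ⟨false, v - u - 1, false,
      (κ + 2) * duration κ false (v - u - 1) - remaining κ (v - 1) u - duration κ true v⟩ := by
  simp only [decodeWindow, if_neg hv, if_neg hu, if_neg hv', if_neg hu', if_neg h, if_true]

end Specifications

set_option linter.unusedSimpArgs false in
lemma decodeWindow_turn {κ : ℤ} (hκ : 2 ≤ κ) (q : Bool) {u v : ℤ} (hu0 : 0 ≤ u)
    (hu1 : u ≤ κ + 1) (hv0 : 0 ≤ v) (hv1 : v ≤ κ + 1) (ht : turns q v = true) :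
    decodeWindow κ (nextState κ q v) (written κ q v) u =
      ⟨(decodeWindow κ q u v).state, (decodeWindow κ q u v).symbol,
        !(decodeWindow κ q u v).turned, (decodeWindow κ q u v).time + duration κ q v⟩ := by
  have step :
      (q = false ∧ v < κ ∧ nextState κ q v = false ∧ written κ q v = v + 1) ∨
      (q = false ∧ κ ≤ v ∧ nextState κ q v = true ∧ written κ q v = v) ∨
      (q = true ∧ 2 ≤ v ∧ v ≤ κ ∧ nextState κ q v = true ∧ written κ q v = v - 1) ∨
      (q = true ∧ κ < v ∧ nextState κ q v = true ∧ written κ q v = 0) := by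
    cases q <;> simp [turns, nextState, written] at ht ⊢ <;> grind
  have hv : v = κ ∨ v = κ + 1 ∨ v < κ := by omega
  have hu : u = 0 ∨ u = κ ∨ u = κ + 1 ∨ (1 ≤ u ∧ u < κ) := by omega
  rcases step with ⟨rfl, h, e₁, e₂⟩ | ⟨rfl, h, e₁, e₂⟩ | ⟨rfl, h, h', e₁, e₂⟩ |
    ⟨rfl, h, e₁, e₂⟩ <;> rw [e₁, e₂] <;> clear e₁ e₂ ht <;>
  rcases lt_trichotomy u v with huv | huv | huv <;>
  rcases hv with hv | hv | hv <;> rcases hu with hu | hu | hu | hu <;>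
  first
  | (exfalso; omega)
  | (subst_vars
     simp (disch := omega) only [duration_false_of_lt, duration_false_of_ge,
      duration_true_of_le_one, duration_true_of_le, duration_true_of_gt, decodeWindow_false_zero,
      decodeWindow_false_top, decodeWindow_false_front_top, decodeWindow_false_of_le,
      decodeWindow_false_of_gt, decodeWindow_true_zero_zero, decodeWindow_true_zero_of_lt,
      decodeWindow_true_zero_of_ge, decodeWindow_true_behind_zero_of_lt,
      decodeWindow_true_behind_zero_of_ge, decodeWindow_true_front_top_of_lt,
      decodeWindow_true_front_top_of_ge, decodeWindow_true_top, decodeWindow_true_of_le,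
      decodeWindow_true_of_gt, remaining, Decoded.mk.injEq, Bool.not_true, Bool.not_false]
     try exact ⟨trivial, by first | trivial | omega, trivial, by ring⟩)

set_option linter.unusedSimpArgs false in
lemma decodeWindow_pass {κ : ℤ} (hκ : 2 ≤ κ) (q : Bool) {u v : ℤ} (hu0 : 0 ≤ u)
    (hu1 : u ≤ κ + 1) (hv0 : 0 ≤ v) (hv1 : v ≤ κ + 1) (ht : turns q v = false) :
    (decodeWindow κ q u v).time + duration κ q v =
      (κ + 2) * duration κ (decodeWindow κ q u v).state (decodeWindow κ q u v).symbol ∧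
    written κ (decodeWindow κ q u v).state (decodeWindow κ q u v).symbol = u ∧
    turns (decodeWindow κ q u v).state (decodeWindow κ q u v).symbol =
      (decodeWindow κ q u v).turned ∧
    nextState κ q v = false ∧
    written κ q v =
      marker κ (nextState κ (decodeWindow κ q u v).state (decodeWindow κ q u v).symbol) := by
  obtain ⟨rfl, h1⟩ := turns_eq_false ht
  obtain rfl | rfl : v = 0 ∨ v = 1 := by omega
  all_goals
    obtain rfl | rfl | rfl | ⟨h1, h2⟩ : u = 0 ∨ u = κ + 1 ∨ u = κ ∨ (1 ≤ u ∧ u < κ) := by omega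
  all_goals
    simp (disch := omega) only [duration_false_of_lt, duration_false_of_ge,
      duration_true_of_le_one, duration_true_of_le, duration_true_of_gt, decodeWindow_false_zero,
      decodeWindow_false_top, decodeWindow_false_front_top, decodeWindow_false_of_le,
      decodeWindow_false_of_gt, decodeWindow_true_zero_zero, decodeWindow_true_zero_of_lt,
      decodeWindow_true_zero_of_ge, decodeWindow_true_behind_zero_of_lt,
      decodeWindow_true_behind_zero_of_ge, decodeWindow_true_front_top_of_lt,
      decodeWindow_true_front_top_of_ge, decodeWindow_true_top, decodeWindow_true_of_le,
      decodeWindow_true_of_gt, remaining, Decoded.mk.injEq, Bool.not_true, Bool.not_false]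
    simp only [written, turns, nextState, marker]
    grind

lemma decodeWindow_marker {κ : ℤ} (hκ : 2 ≤ κ) (q : Bool) (v : ℤ) :
    decodeWindow κ false (marker κ q) v = ⟨q, v, false, 0⟩ := by
  cases q <;> simp [decodeWindow, marker]; omega

end CounterMachine

namespace CounterMachine

open Tape

/-- Control states: the state, whether the head faces right, and a counter. -/
abbrev Control (κ : ℕ) := Bool × Bool × Fin (κ * (κ + 2) * κ + 1)

/-- A state, a direction, a counter, and the letters behind and in front of the head, where
the counter is smaller than the duration of the next step. -/
@[ext]
structure Window (κ : ℕ) where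
  state : Bool
  right : Bool
  counter : Fin (κ * (κ + 2) * κ + 1)
  back : Fin (κ + 2)
  front : Fin (κ + 2)
  counter_lt : (counter : ℤ) < duration κ state (front : ℕ)

variable {κ : ℕ} {J : Type*}

instance : Finite (Window κ) :=
  Finite.of_injective (fun w : Window κ => (w.state, w.right, w.counter, w.back, w.front))
    fun w w' h => by
      simp only [Prod.mk.injEq] at h
      exact Window.ext h.1 h.2.1 h.2.2.1 h.2.2.2.1 h.2.2.2.2

/-- The control and the letters to the left and to the right of the head. -/
def arrange (q D : Bool) (s : Fin (κ * (κ + 2) * κ + 1)) (u v : Fin (κ + 2)) :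
    (Control κ ⊕ J) × Fin (κ + 2) × Fin (κ + 2) :=
  (Sum.inl (q, D, s), cond D u v, cond D v u)

lemma arrange_inj {q q' D D' : Bool} {s s' : Fin (κ * (κ + 2) * κ + 1)} {u u' v v' : Fin (κ + 2)}
    (h : (arrange q D s u v : (Control κ ⊕ J) × _) = arrange q' D' s' u' v') :
    q = q' ∧ D = D' ∧ s = s' ∧ u = u' ∧ v = v' := by
  simp only [arrange, Prod.mk.injEq, Sum.inl.injEq] at h
  obtain ⟨⟨rfl, rfl, rfl⟩, h1, h2⟩ := h
  cases D <;> simp_all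

/-- The embedding of windows. -/
def Window.embed (κ : ℕ) (J : Type*) :
    Window κ ↪ (Control κ ⊕ J) × Fin (κ + 2) × Fin (κ + 2) where
  toFun w := arrange w.state w.right w.counter w.back w.front
  inj' w w' h := by
    obtain ⟨h1, h2, h3, h4, h5⟩ := arrange_inj h
    exact Window.ext h1 h2 h3 h4 h5

lemma arrange_notMem_range {q D : Bool} {s : Fin (κ * (κ + 2) * κ + 1)} {u v : Fin (κ + 2)}
    (h : ¬(s : ℤ) < duration κ q (v : ℕ)) : arrange q D s u v ∉ Set.range (Window.embed κ J) := by
  rintro ⟨w, hw⟩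
  obtain ⟨rfl, rfl, rfl, rfl, rfl⟩ := arrange_inj hw
  exact h w.counter_lt

lemma inr_notMem_range (j : J) (l r : Fin (κ + 2)) :
    (Sum.inr j, l, r) ∉ Set.range (Window.embed κ J) := by
  rintro ⟨w, hw⟩
  simp [Window.embed, arrange] at hw

/-- Advance the counter cyclically. -/
def Window.tick (hκ : 2 ≤ κ) (w : Window κ) : Window κ where
  state := w.state
  right := w.right
  counter := if h : (w.counter : ℤ) + 1 < duration κ w.state (w.front : ℕ) then
      ⟨w.counter + 1, by
        have := duration_le (κ := κ) (by exact_mod_cast hκ) w.state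
          (v := (w.front : ℕ)) (by positivity)
        zify; linarith⟩
    else 0
  back := w.back
  front := w.front
  counter_lt := by
    split_ifs with h
    · exact_mod_cast h
    · simpa using duration_pos (κ := κ) (by exact_mod_cast hκ) w.state (w.front : ℕ)

lemma Window.tick_injective (hκ : 2 ≤ κ) : Function.Injective (Window.tick hκ) := by
  intro w w' h
  simp only [tick, Window.mk.injEq] at h
  obtain ⟨h1, h2, h3, h4, h5⟩ := h
  have e := w.counter_lt
  have e' := w'.counter_lt
  refine Window.ext h1 h2 ?_ h4 h5
  rw [h1, h5] at e
  simp only [h1, h5] at h3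
  split_ifs at h3 with i1 i2 i2 <;> simp only [Fin.ext_iff] at h3 ⊢
  · simpa using h3
  · simp at h3
  · simp at h3
  · zify; omega

/-- The letter written, as an element of the alphabet. -/
def writtenFin (hκ : 2 ≤ κ) (q : Bool) (v : Fin (κ + 2)) : Fin (κ + 2) :=
  ⟨(written κ q (v : ℕ)).toNat, by
    have h1 := written_nonneg (κ := κ) (by exact_mod_cast hκ) q (v := (v : ℕ)) (by positivity)
    have h2 := written_le (κ := κ) (by exact_mod_cast hκ) q (v := (v : ℕ)) (by omega)
    omega⟩

lemma coe_writtenFin (hκ : 2 ≤ κ) (q : Bool) (v : Fin (κ + 2)) :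
    ((writtenFin hκ q v : ℕ) : ℤ) = written κ q (v : ℕ) :=
  Int.toNat_of_nonneg (written_nonneg (by exact_mod_cast hκ) q (by positivity))

/-- The marker, as an element of the alphabet. -/
def markerFin (κ : ℕ) (q : Bool) : Fin (κ + 2) := if q then Fin.last (κ + 1) else 0

lemma coe_markerFin (q : Bool) : ((markerFin κ q : ℕ) : ℤ) = marker κ q := by
  cases q <;> simp [markerFin, marker]

/-- The transition on the state, the direction and the letter read. -/
def transition (hκ : 2 ≤ κ) (x : Bool × Bool × Fin (κ + 2)) : Bool × Bool × Fin (κ + 2) :=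
  (nextState κ x.1 (x.2.2 : ℕ), xor x.2.1 (turns x.1 (x.2.2 : ℕ)), writtenFin hκ x.1 x.2.2)

lemma transition_injective (hκ : 2 ≤ κ) : Function.Injective (transition hκ) := by
  rintro ⟨q, D, v⟩ ⟨q', D', v'⟩ h
  simp only [transition, Prod.mk.injEq] at h
  obtain ⟨h1, h2, h3⟩ := h
  have h3' : written κ q (v : ℕ) = written κ q' (v' : ℕ) := by
    rw [← coe_writtenFin hκ, ← coe_writtenFin hκ, h3]
  obtain ⟨rfl, hv⟩ := step_injective (by exact_mod_cast hκ) (by positivity) (by omega)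
    (by positivity) (by omega) h1 h3'
  obtain rfl : v = v' := Fin.ext (by exact_mod_cast hv)
  simpa using h2

/-- The decoded simulated state, direction, letter and time. -/
def Window.decode (w : Window κ) : Bool × Bool × ℤ × ℤ :=
  ((decodeWindow κ w.state (w.back : ℕ) (w.front : ℕ)).state,
    xor w.right (decodeWindow κ w.state (w.back : ℕ) (w.front : ℕ)).turned,
    (decodeWindow κ w.state (w.back : ℕ) (w.front : ℕ)).symbol,
    (decodeWindow κ w.state (w.back : ℕ) (w.front : ℕ)).time + (w.counter : ℤ))

/-- The window after turning around. -/
def Window.turn (hκ : 2 ≤ κ) (w : Window κ) : Window κ where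
  state := nextState κ w.state (w.front : ℕ)
  right := !w.right
  counter := 0
  back := writtenFin hκ w.state w.front
  front := w.back
  counter_lt := by simpa using duration_pos (κ := κ) (by exact_mod_cast hκ) _ _

/-- The window in which the simulation of a step starts. -/
def Window.entry (hκ : 2 ≤ κ) (q D : Bool) (v : Fin (κ + 2)) : Window κ where
  state := false
  right := D
  counter := 0
  back := markerFin κ q
  front := v
  counter_lt := by simpa using duration_pos (κ := κ) (by exact_mod_cast hκ) _ _

lemma Window.decode_entry (hκ : 2 ≤ κ) (q D : Bool) (v : Fin (κ + 2)) :
    (Window.entry hκ q D v).decode = (q, D, ((v : ℕ) : ℤ), 0) := by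
  simp only [entry, decode, coe_markerFin, decodeWindow_marker (κ := κ) (by exact_mod_cast hκ)]
  simp

lemma Window.decode_tick (hκ : 2 ≤ κ) (w : Window κ)
    (h : (w.counter : ℤ) + 1 < duration κ w.state (w.front : ℕ)) :
    (w.tick hκ).decode =
      (w.decode.1, w.decode.2.1, w.decode.2.2.1, w.decode.2.2.2 + 1) := by
  simp [tick, decode, h, add_assoc]

lemma Window.decode_turn (hκ : 2 ≤ κ) (w : Window κ)
    (h : (w.counter : ℤ) + 1 = duration κ w.state (w.front : ℕ))
    (ht : turns w.state (w.front : ℕ) = true) :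
    (w.turn hκ).decode =
      (w.decode.1, w.decode.2.1, w.decode.2.2.1, w.decode.2.2.2 + 1) := by
  have key := decodeWindow_turn (κ := κ) (by exact_mod_cast hκ) w.state (u := (w.back : ℕ))
    (v := (w.front : ℕ)) (by positivity) (by omega) (by positivity) (by omega) ht
  simp only [turn, decode, coe_writtenFin, key]
  simp [← h, add_assoc]

lemma Window.exists_decode (hκ : 2 ≤ κ) (q D : Bool) (v : Fin (κ + 2)) (τ : ℕ) :
    (τ : ℤ) < (κ + 2) * duration κ q (v : ℕ) →
      ∃ w : Window κ, w.decode = (q, D, ((v : ℕ) : ℤ), (τ : ℤ)) := by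
  induction τ with
  | zero => exact fun _ => ⟨entry hκ q D v, by simp [decode_entry]⟩
  | succ τ ih =>
    intro hτ
    obtain ⟨w, hw⟩ := ih (by push_cast at hτ; linarith)
    rcases lt_or_ge ((w.counter : ℤ) + 1) (duration κ w.state (w.front : ℕ)) with h | h
    · exact ⟨w.tick hκ, by rw [decode_tick hκ w h, hw]; simp⟩
    · have h' := le_antisymm (Int.add_one_le_iff.2 w.counter_lt) h
      cases ht : turns w.state (w.front : ℕ)
      · have key := (decodeWindow_pass (κ := κ) (by exact_mod_cast hκ) w.state (u := (w.back : ℕ))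
          (v := (w.front : ℕ)) (by positivity) (by omega) (by positivity) (by omega) ht).1
        simp only [decode, Prod.mk.injEq] at hw
        obtain ⟨e1, -, e2, e3⟩ := hw
        rw [e1, e2] at key
        push_cast at hτ
        linarith
      · exact ⟨w.turn hκ, by rw [decode_turn hκ w h' ht, hw]; simp⟩

lemma Window.exists_encode (hκ : 2 ≤ κ) (w : Window κ) : ∃ w' : Window κ,
    w'.decode = (w.state, w.right, ((w.front : ℕ) : ℤ),
      ((κ + 2) * (w.counter : ℤ) + (w.back : ℕ) : ℤ)) := by
  have h := w.counter_lt
  obtain ⟨w', hw'⟩ := exists_decode hκ w.state w.right w.front ((κ + 2) * w.counter + w.back) (by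
    have : (w.back : ℤ) < κ + 2 := by exact_mod_cast w.back.2
    push_cast
    nlinarith)
  exact ⟨w', by rw [hw']; push_cast; rfl⟩

/-- The window whose decoded time accounts for the counter and the letter behind the head. -/
noncomputable def Window.encode (hκ : 2 ≤ κ) (w : Window κ) : Window κ :=
  (w.exists_encode hκ).choose

lemma Window.decode_encode (hκ : 2 ≤ κ) (w : Window κ) :
    (w.encode hκ).decode = (w.state, w.right, ((w.front : ℕ) : ℤ),
      ((κ + 2) * (w.counter : ℤ) + (w.back : ℕ) : ℤ)) :=
  (w.exists_encode hκ).choose_spec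

lemma Window.decode_comp_encode_injective (hκ : 2 ≤ κ) :
    Function.Injective (decode ∘ Window.encode hκ) := by
  intro w w' h
  simp only [Function.comp_apply, decode_encode, Prod.mk.injEq] at h
  obtain ⟨h1, h2, h3, h4⟩ := h
  have e1 := w.back.2
  have e2 := w'.back.2
  have h4' : (κ + 2) * (w.counter : ℕ) + (w.back : ℕ) = (κ + 2) * w'.counter + w'.back := by
    exact_mod_cast h4
  have h5 : (w.back : ℕ) = w'.back := by
    have := congrArg (· % (κ + 2)) h4'
    simpa [Nat.mul_add_mod, Nat.mod_eq_of_lt e1, Nat.mod_eq_of_lt e2] using this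
  have h6 : (w.counter : ℕ) = w'.counter := by
    rw [h5] at h4'
    exact Nat.eq_of_mul_eq_mul_left (by omega) (Nat.add_right_cancel h4')
  exact Window.ext h1 h2 (Fin.ext h6) (Fin.ext h5) (Fin.ext (by exact_mod_cast h3))

lemma Window.encode_bijective (hκ : 2 ≤ κ) : Function.Bijective (Window.encode hκ) :=
  Finite.injective_iff_bijective.1 (decode_comp_encode_injective hκ).of_comp

lemma Window.decode_injective (hκ : 2 ≤ κ) : Function.Injective (decode : Window κ → _) := by
  intro w w' h
  obtain ⟨x, rfl⟩ := (encode_bijective hκ).2 w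
  obtain ⟨x', rfl⟩ := (encode_bijective hκ).2 w'
  rw [decode_comp_encode_injective hκ h]

lemma Window.decode_time_lt (hκ : 2 ≤ κ) (w : Window κ) :
    w.decode.2.2.2 < (κ + 2) * duration κ w.decode.1 w.decode.2.2.1 := by
  obtain ⟨w, rfl⟩ := (encode_bijective hκ).2 w
  rw [decode_encode]
  have := w.counter_lt
  have : (w.back : ℤ) < κ + 2 := by exact_mod_cast w.back.2
  simp only
  nlinarith

end CounterMachine

namespace CounterMachine

open Tape

variable {κ : ℕ} {J : Type*} (b : ℤ)

/-- The control together with the letters to the left and right of the head, with the rest. -/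
def place {C B : Type*} (x : C × B × B) (L R : ℕ → B) (p : ℤ) : Config C B :=
  (x.1, cons x.2.1 L, cons x.2.2 R, p)

lemma loc_place {C B : Type*} (τ : Equiv.Perm (C × B × B)) (x : C × B × B) (L R : ℕ → B) (p : ℤ) :
    loc τ (place x L R p) = place (τ x) L R p := rfl

/-- The configuration with front tape `F` and back tape `K`. -/
def facing (J : Type*) (q D : Bool) (s : Fin (κ * (κ + 2) * κ + 1)) (F K : ℕ → Fin (κ + 2))
    (p : ℤ) : Config (Control κ ⊕ J) (Fin (κ + 2)) :=
  (Sum.inl (q, D, s), cond D K F, cond D F K, p)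

lemma place_arrange (q D : Bool) (s : Fin (κ * (κ + 2) * κ + 1)) (u v : Fin (κ + 2))
    (L R : ℕ → Fin (κ + 2)) (p : ℤ) :
    place (arrange q D s u v : (Control κ ⊕ J) × _) L R p =
      facing J q D s (cons v (cond D R L)) (cons u (cond D L R)) p := by
  cases D <;> rfl

lemma facing_cons (q D : Bool) (s : Fin (κ * (κ + 2) * κ + 1)) (u v : Fin (κ + 2))
    (F K : ℕ → Fin (κ + 2)) (p : ℤ) :
    facing J q D s (cons v F) (cons u K) p =
      place (arrange q D s u v) (cond D K F) (cond D F K) p := by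
  cases D <;> rfl

lemma config_cases (ω : Config (Control κ ⊕ J) (Fin (κ + 2))) :
    (∃ j L R p, ω = (Sum.inr j, L, R, p)) ∨ ∃ q D s v F K p, ω = facing J q D s (cons v F) K p := by
  obtain ⟨⟨q, D, s⟩ | j, L, R, p⟩ := ω
  · cases D
    · exact Or.inr ⟨q, false, s, L 0, tail L, R, p, by simp [facing]⟩
    · exact Or.inr ⟨q, true, s, R 0, tail R, L, p, by simp [facing]⟩
  · exact Or.inl ⟨j, L, R, p, rfl⟩

lemma Window.embed_apply (w : Window κ) :
    Window.embed κ J w = arrange w.state w.right w.counter w.back w.front := rfl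

/-- Advance the counter. -/
noncomputable def tickPerm (hκ : 2 ≤ κ) (J : Type*) :
    Equiv.Perm ((Control κ ⊕ J) × Fin (κ + 2) × Fin (κ + 2)) :=
  Equiv.Perm.viaEmbedding
    (Equiv.ofBijective _ (Finite.injective_iff_bijective.1 (Window.tick_injective hκ)))
    (Window.embed κ J)

/-- Encode the counter and the letter behind the head. -/
noncomputable def encodePerm (hκ : 2 ≤ κ) (J : Type*) :
    Equiv.Perm ((Control κ ⊕ J) × Fin (κ + 2) × Fin (κ + 2)) :=
  Equiv.Perm.viaEmbedding (Equiv.ofBijective _ (Window.encode_bijective hκ)) (Window.embed κ J)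

/-- The embedding of the data on which the transition acts. -/
def transitionEmbed (κ : ℕ) (J : Type*) :
    (Bool × Bool × Fin (κ + 2)) × Fin (κ + 2) ↪ (Control κ ⊕ J) × Fin (κ + 2) × Fin (κ + 2) where
  toFun x := (Sum.inl (x.1.1, x.1.2.1, 0), x.2, x.1.2.2)
  inj' x y h := by
    simp only [Prod.mk.injEq, Sum.inl.injEq] at h
    ext1
    · ext1; · exact h.1.1
      ext1
      exacts [h.1.2.1, h.2.2]
    · exact h.2.1

/-- Apply the transition to the letter right of the head if the counter vanishes. -/
noncomputable def transitionPerm (hκ : 2 ≤ κ) (J : Type*) :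
    Equiv.Perm ((Control κ ⊕ J) × Fin (κ + 2) × Fin (κ + 2)) :=
  Equiv.Perm.viaEmbedding
    ((Equiv.ofBijective _ (Finite.injective_iff_bijective.1 (transition_injective hκ))).prodCongr
      (1 : Equiv.Perm (Fin (κ + 2)))) (transitionEmbed κ J)

/-- Whether the counter vanishes and the head faces in the direction `D`. -/
def ready (J : Type*) (D : Bool) : Control κ ⊕ J → Bool
  | Sum.inl (_, D', s) => D == D' && s == 0
  | Sum.inr _ => false

/-- Whether the head faces right. -/
def facesRight (J : Type*) : Control κ ⊕ J → Bool
  | Sum.inl (_, D, _) => D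
  | Sum.inr _ => false

/-- The counter machine. -/
noncomputable def machine (hκ : 2 ≤ κ) (J : Type*) :
    Equiv.Perm (Config (Control κ ⊕ J) (Fin (κ + 2))) :=
  move b (ready J true) * loc (transitionPerm hκ J) * (move b (ready J false))⁻¹ *
    loc (tickPerm hκ J)

/-- The conjugator between a power of the machine and its fattening. -/
noncomputable def conjugator (hκ : 2 ≤ κ) (J : Type*) :
    Equiv.Perm (Config (Control κ ⊕ J) (Fin (κ + 2))) :=
  loc (encodePerm hκ J) * move b (facesRight J)

lemma hasWord_machine (hκ : 2 ≤ κ) : HasWord (gens (Control κ ⊕ J) (Fin (κ + 2)) b) 4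
    (machine b hκ J) := by
  have hm (φ) : HasWord (gens (Control κ ⊕ J) (Fin (κ + 2)) b) 1 (move b φ) :=
    .of_mem (Or.inr ⟨φ, rfl⟩)
  have hl (τ) : HasWord (gens (Control κ ⊕ J) (Fin (κ + 2)) b) 1 (loc τ) :=
    .of_mem (Or.inl ⟨τ, rfl⟩)
  exact (((hm _).mul (hl _)).mul (hm _).inv).mul (hl _)

lemma hasWord_conjugator (hκ : 2 ≤ κ) : HasWord (gens (Control κ ⊕ J) (Fin (κ + 2)) b) 4
    (conjugator b hκ J) := by
  have hm : HasWord (gens (Control κ ⊕ J) (Fin (κ + 2)) b) 1 (move b (facesRight J)) :=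
    .of_mem (Or.inr ⟨_, rfl⟩)
  have hl : HasWord (gens (Control κ ⊕ J) (Fin (κ + 2)) b) 1 (loc (encodePerm hκ J)) :=
    .of_mem (Or.inl ⟨_, rfl⟩)
  exact (hl.mul hm).mono (by norm_num)

lemma tickPerm_embed (hκ : 2 ≤ κ) (w : Window κ) :
    tickPerm hκ J (Window.embed κ J w) = Window.embed κ J (w.tick hκ) := by
  simp [tickPerm, Equiv.Perm.viaEmbedding_apply]

lemma encodePerm_embed (hκ : 2 ≤ κ) (w : Window κ) :
    encodePerm hκ J (Window.embed κ J w) = Window.embed κ J (w.encode hκ) := by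
  simp [encodePerm, Equiv.Perm.viaEmbedding_apply]

lemma transitionPerm_apply (hκ : 2 ≤ κ) (q D : Bool) (l v : Fin (κ + 2)) :
    transitionPerm hκ J (Sum.inl (q, D, 0), l, v) =
      (Sum.inl (nextState κ q (v : ℕ), xor D (turns q (v : ℕ)), 0), l, writtenFin hκ q v) :=
  Equiv.Perm.viaEmbedding_apply _ (transitionEmbed κ J) ((q, D, v), l)

lemma machine_of_notMem_range (hκ : 2 ≤ κ)
    {x : (Control κ ⊕ J) × Fin (κ + 2) × Fin (κ + 2)} (hx : x ∉ Set.range (Window.embed κ J))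
    (L R : ℕ → Fin (κ + 2)) (p : ℤ) : machine b hκ J (place x L R p) = place x L R p := by
  have h0 : ∀ q D s, x.1 = Sum.inl (q, D, s) → s ≠ 0 := by
    rintro q D s hs rfl
    refine hx ⟨⟨q, D, 0, cond D x.2.1 x.2.2, cond D x.2.2 x.2.1, ?_⟩, ?_⟩
    · simpa using duration_pos (κ := κ) (by exact_mod_cast hκ) _ _
    · obtain ⟨c, l, r⟩ := x
      simp only at hs
      subst hs
      cases D <;> rfl
  have hr : ∀ D, ready J D x.1 = false := by
    intro D
    rcases hc : x.1 with ⟨q, D', s⟩ | j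
    · simp [ready, h0 _ _ _ hc]
    · rfl
  have ht : x ∉ Set.range (transitionEmbed κ J) := by
    rintro ⟨y, rfl⟩
    exact h0 _ _ _ rfl rfl
  simp only [machine, Equiv.Perm.mul_apply, loc_place]
  rw [tickPerm, Equiv.Perm.viaEmbedding_apply_of_notMem _ _ _ hx]
  rw [show (move b (ready J false))⁻¹ (place x L R p) = place x L R p from
    move_symm_apply_false b (hr _) _ _ _, loc_place, transitionPerm,
    Equiv.Perm.viaEmbedding_apply_of_notMem _ _ _ ht]
  exact move_apply_false b (hr _) _ _ _

lemma machine_of_lt (hκ : 2 ≤ κ) (w : Window κ)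
    (h : (w.counter : ℤ) + 1 < duration κ w.state (w.front : ℕ)) (L R : ℕ → Fin (κ + 2)) (p : ℤ) :
    machine b hκ J (place (Window.embed κ J w) L R p) =
      place (Window.embed κ J (w.tick hκ)) L R p := by
  have h0 : (w.tick hκ).counter ≠ 0 := Fin.ne_of_val_ne (by simp [Window.tick, h])
  have hr : ∀ D, ready J D (Window.embed κ J (w.tick hκ)).1 = false := by
    intro D
    simp [ready, Window.embed_apply, arrange, h0]
  have ht : Window.embed κ J (w.tick hκ) ∉ Set.range (transitionEmbed κ J) := by
    rintro ⟨y, hy⟩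
    have : (Sum.inl (y.1.1, y.1.2.1, 0) : Control κ ⊕ J) =
      Sum.inl ((w.tick hκ).state, (w.tick hκ).right, (w.tick hκ).counter) := congrArg Prod.fst hy
    simp only [Sum.inl.injEq, Prod.mk.injEq] at this
    exact h0 this.2.2.symm
  simp only [machine, Equiv.Perm.mul_apply, loc_place, tickPerm_embed]
  rw [show (move b (ready J false))⁻¹ (place (Window.embed κ J (w.tick hκ)) L R p) =
    place (Window.embed κ J (w.tick hκ)) L R p from
    move_symm_apply_false b (hr _) _ _ _, loc_place, transitionPerm,
    Equiv.Perm.viaEmbedding_apply_of_notMem _ _ _ ht]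
  exact move_apply_false b (hr _) _ _ _

/-- The displacement of a head which faces in the direction `D`. -/
def disp (D : Bool) : ℤ := cond D b (-b)

lemma machine_of_eq (hκ : 2 ≤ κ) (q D : Bool) (s : Fin (κ * (κ + 2) * κ + 1)) (v : Fin (κ + 2))
    (h : (s : ℤ) + 1 = duration κ q (v : ℕ)) (F K : ℕ → Fin (κ + 2)) (p : ℤ) :
    machine b hκ J (facing J q D s (cons v F) K p) =
      if turns q (v : ℕ) then
        facing J (nextState κ q (v : ℕ)) (!D) 0 K (cons (writtenFin hκ q v) F) p
      else
        facing J (nextState κ q (v : ℕ)) D 0 F (cons (writtenFin hκ q v) K) (p + disp b D) := by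
  obtain ⟨u, K, rfl⟩ := exists_cons K
  have ht : loc (tickPerm hκ J) (facing J q D s (cons v F) (cons u K) p) =
      facing J q D 0 (cons v F) (cons u K) p := by
    have := tickPerm_embed (J := J) hκ ⟨q, D, s, u, v, by omega⟩
    rw [facing_cons, loc_place]
    refine (congrArg (fun x => place x _ _ p) this).trans ?_
    rw [facing_cons]
    simp [Window.embed_apply, Window.tick, h]
  rw [machine, Equiv.Perm.mul_apply, ht]
  cases D
  · have h1 : (move b (ready J false))⁻¹ (facing J q false 0 (cons v F) (cons u K) p) =
        (Sum.inl (q, false, 0), F, cons v (cons u K), p - b) :=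
      move_symm_apply_true b (by simp [ready]) _ _ _ _
    obtain ⟨f, F, rfl⟩ := exists_cons F
    rw [Equiv.Perm.mul_apply, h1, Equiv.Perm.mul_apply, loc_apply, transitionPerm_apply]
    cases turns q (v : ℕ)
    · rw [move_apply_false b (by simp [ready])]
      simp [facing, disp, sub_eq_add_neg]
    · rw [move_apply_true b (by simp [ready])]
      simp [facing]
  · have h1 : (move b (ready J false))⁻¹ (facing J q true 0 (cons v F) (cons u K) p) =
        (Sum.inl (q, true, 0), cons u K, cons v F, p) :=
      move_symm_apply_false b (by simp [ready]) _ _ _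
    rw [Equiv.Perm.mul_apply, h1, Equiv.Perm.mul_apply, loc_apply, transitionPerm_apply]
    cases turns q (v : ℕ)
    · rw [move_apply_true b (by simp [ready])]
      simp [facing, disp]
    · rw [move_apply_false b (by simp [ready])]
      simp [facing]

lemma machine_turn (hκ : 2 ≤ κ) (w : Window κ)
    (h : (w.counter : ℤ) + 1 = duration κ w.state (w.front : ℕ))
    (ht : turns w.state (w.front : ℕ) = true) (L R : ℕ → Fin (κ + 2)) (p : ℤ) :
    machine b hκ J (place (Window.embed κ J w) L R p) =
      place (Window.embed κ J (w.turn hκ)) L R p := by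
  obtain ⟨q, D, s, u, v, hs⟩ := w
  change machine b hκ J (place (arrange q D s u v) L R p) = _
  rw [place_arrange, machine_of_eq b hκ q D s v h, if_pos ht]
  change _ = place (arrange (nextState κ q (v : ℕ)) (!D) 0 (writtenFin hκ q v) u) L R p
  rw [place_arrange]
  cases D <;> rfl

/-- The displacement of the head before encoding. -/
def disp' (D : Bool) : ℤ := cond D b 0

lemma conjugator_facing (hκ : 2 ≤ κ) (q D : Bool) (s : Fin (κ * (κ + 2) * κ + 1))
    (v : Fin (κ + 2)) (h : (s : ℤ) < duration κ q (v : ℕ)) (F K : ℕ → Fin (κ + 2)) (p : ℤ)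
    (d : Fin (κ + 2)) :
    conjugator b hκ J (insertLetter (facing J q D s (cons v F) K p, d)) =
      place (Window.embed κ J (Window.encode hκ ⟨q, D, s, d, v, h⟩)) (cond D K F) (cond D F K)
        (p + disp' b D) := by
  have hm : move b (facesRight J) (insertLetter (facing J q D s (cons v F) K p, d)) =
      place (Window.embed κ J ⟨q, D, s, d, v, h⟩) (cond D K F) (cond D F K) (p + disp' b D) := by
    cases D
    · exact (move_apply_false b rfl _ _ _).trans
        (by simp [disp', place, Window.embed_apply, arrange, facing])
    · exact move_apply_true b rfl _ _ _ _
  rw [conjugator, Equiv.Perm.mul_apply, hm, loc_place, encodePerm_embed]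

lemma machine_conjugator_of_notMem (hκ : 2 ≤ κ) (q D : Bool) (s : Fin (κ * (κ + 2) * κ + 1))
    (v : Fin (κ + 2)) (h : ¬(s : ℤ) < duration κ q (v : ℕ)) (F K : ℕ → Fin (κ + 2)) (p : ℤ)
    (d : Fin (κ + 2)) :
    machine b hκ J (conjugator b hκ J (insertLetter (facing J q D s (cons v F) K p, d))) =
      conjugator b hκ J (insertLetter (facing J q D s (cons v F) K p, d)) := by
  have hx : arrange q D s d v ∉ Set.range (Window.embed κ J) := arrange_notMem_range h
  have hm : move b (facesRight J) (insertLetter (facing J q D s (cons v F) K p, d)) =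
      place (arrange q D s d v) (cond D K F) (cond D F K) (p + disp' b D) := by
    cases D
    · exact (move_apply_false b rfl _ _ _).trans
        (by simp [disp', place, arrange, facing])
    · exact move_apply_true b rfl _ _ _ _
  rw [conjugator, Equiv.Perm.mul_apply, hm, loc_place, encodePerm,
    Equiv.Perm.viaEmbedding_apply_of_notMem _ _ _ hx, machine_of_notMem_range b hκ hx]

lemma machine_conjugator_inr (hκ : 2 ≤ κ) (j : J) (L R : ℕ → Fin (κ + 2)) (p : ℤ)
    (d : Fin (κ + 2)) :
    machine b hκ J (conjugator b hκ J (insertLetter ((Sum.inr j, L, R, p), d))) =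
      conjugator b hκ J (insertLetter ((Sum.inr j, L, R, p), d)) := by
  obtain ⟨l, L, rfl⟩ := exists_cons L
  have hx := inr_notMem_range (κ := κ) j l d
  have hm : move b (facesRight (κ := κ) J) (insertLetter ((Sum.inr j, cons l L, R, p), d)) =
      place (Sum.inr j, l, d) L R p := move_apply_false b rfl _ _ _
  rw [conjugator, Equiv.Perm.mul_apply, hm, loc_place, encodePerm,
    Equiv.Perm.viaEmbedding_apply_of_notMem _ _ _ hx, machine_of_notMem_range b hκ hx]

end CounterMachine

namespace CounterMachine

open Tape

variable {κ : ℕ} {J : Type*} (b : ℤ)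

lemma machine_window (hκ : 2 ≤ κ) (w : Window κ) :
    (∃ w' : Window κ, w'.decode = (w.decode.1, w.decode.2.1, w.decode.2.2.1, w.decode.2.2.2 + 1) ∧
      ∀ L R p, machine b hκ J (place (Window.embed κ J w) L R p) =
        place (Window.embed κ J w') L R p) ∨
    (w.counter : ℤ) + 1 = duration κ w.state (w.front : ℕ) ∧
      turns w.state (w.front : ℕ) = false := by
  rcases lt_or_ge ((w.counter : ℤ) + 1) (duration κ w.state (w.front : ℕ)) with h | h
  · exact Or.inl ⟨w.tick hκ, w.decode_tick hκ h, machine_of_lt b hκ w h⟩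
  · have h' := le_antisymm (Int.add_one_le_iff.2 w.counter_lt) h
    cases ht : turns w.state (w.front : ℕ)
    · exact Or.inr ⟨h', rfl⟩
    · exact Or.inl ⟨w.turn hκ, w.decode_turn hκ h' ht, machine_turn b hκ w h' ht⟩

lemma Window.pass (hκ : 2 ≤ κ) (w : Window κ) {q D : Bool} {v : Fin (κ + 2)} {τ : ℤ}
    (hw : w.decode = (q, D, ((v : ℕ) : ℤ), τ))
    (h : (w.counter : ℤ) + 1 = duration κ w.state (w.front : ℕ))
    (ht : turns w.state (w.front : ℕ) = false) :
    τ + 1 = (κ + 2) * duration κ q (v : ℕ) ∧ w.back = writtenFin hκ q v ∧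
      w.right = xor D (turns q (v : ℕ)) ∧ nextState κ w.state (w.front : ℕ) = false ∧
      writtenFin hκ w.state w.front = markerFin κ (nextState κ q (v : ℕ)) := by
  obtain ⟨k1, k2, k3, k4, k5⟩ := decodeWindow_pass (κ := κ) (by exact_mod_cast hκ) w.state
    (u := (w.back : ℕ)) (v := (w.front : ℕ)) (by positivity) (by omega)
    (by positivity) (by omega) ht
  simp only [decode, Prod.mk.injEq] at hw
  obtain ⟨e1, e2, e3, e4⟩ := hw
  rw [e1, e3] at k1 k2 k3 k5
  refine ⟨by linarith, Fin.ext ?_, ?_, k4, Fin.ext ?_⟩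
  · rw [← coe_writtenFin hκ] at k2
    exact_mod_cast k2.symm
  · rw [k3, ← e2]; simp
  · rw [← coe_writtenFin hκ, ← coe_markerFin] at k5
    exact_mod_cast k5

lemma machine_conjugator_succ (hκ : 2 ≤ κ) (q D : Bool) (s : Fin (κ * (κ + 2) * κ + 1))
    (v : Fin (κ + 2)) (h : (s : ℤ) < duration κ q (v : ℕ)) (F K : ℕ → Fin (κ + 2)) (p : ℤ)
    (d : ℕ) (hd : d + 1 < κ + 2) :
    machine b hκ J (conjugator b hκ J (insertLetter (facing J q D s (cons v F) K p,
      ⟨d, by omega⟩))) =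
      conjugator b hκ J (insertLetter (facing J q D s (cons v F) K p, ⟨d + 1, hd⟩)) := by
  rw [conjugator_facing b hκ q D s v h, conjugator_facing b hκ q D s v h]
  set w := Window.encode hκ ⟨q, D, s, ⟨d, by omega⟩, v, h⟩ with hwdef
  have hw := Window.decode_encode hκ ⟨q, D, s, ⟨d, by omega⟩, v, h⟩
  simp only [← hwdef] at hw
  rcases machine_window b (J := J) hκ w with ⟨w', hw', hm⟩ | ⟨h1, h2⟩
  · rw [hm]
    congr 2
    apply Window.decode_injective hκ
    rw [Window.decode_encode, hw', hw]
    simp [add_assoc]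
  · have := (w.pass hκ hw h1 h2).1
    have : (d : ℤ) + 1 < κ + 2 := by exact_mod_cast hd
    nlinarith

lemma conjugator_entry (hκ : 2 ≤ κ) (q D : Bool) (F K : ℕ → Fin (κ + 2)) (p : ℤ) :
    conjugator b hκ J (insertLetter (facing J q D 0 F K p, 0)) =
      facing J false D 0 F (cons (markerFin κ q) K) (p + disp' b D) := by
  obtain ⟨v, F, rfl⟩ := exists_cons F
  have h0 : (((0 : Fin (κ * (κ + 2) * κ + 1)) : ℕ) : ℤ) < duration κ q (v : ℕ) := by
    simpa using duration_pos (κ := κ) (by exact_mod_cast hκ) q (v : ℕ)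
  rw [conjugator_facing b hκ q D 0 v h0]
  have : Window.encode hκ ⟨q, D, 0, 0, v, h0⟩ = Window.entry hκ q D v := by
    apply Window.decode_injective hκ
    rw [Window.decode_encode, Window.decode_entry]
    simp
  rw [this, facing_cons]
  rfl

lemma machine_facing_of_lt (hκ : 2 ≤ κ) (q D : Bool) (s s' : Fin (κ * (κ + 2) * κ + 1))
    (v : Fin (κ + 2)) (h : (s : ℤ) + 1 < duration κ q (v : ℕ)) (hs : (s' : ℕ) = s + 1)
    (F K : ℕ → Fin (κ + 2)) (p : ℤ) :
    machine b hκ J (facing J q D s (cons v F) K p) = facing J q D s' (cons v F) K p := by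
  obtain ⟨u, K, rfl⟩ := exists_cons K
  rw [facing_cons, facing_cons]
  refine (machine_of_lt b hκ ⟨q, D, s, u, v, by omega⟩ h _ _ p).trans ?_
  have : s' = (Window.tick hκ ⟨q, D, s, u, v, by omega⟩).counter :=
    Fin.ext (by simp [Window.tick, h, hs])
  exact congrArg (fun s => place (arrange q D s u v) _ _ p) this.symm

lemma machine_conjugator_last (hκ : 2 ≤ κ) (q D : Bool) (s : Fin (κ * (κ + 2) * κ + 1))
    (v : Fin (κ + 2)) (h : (s : ℤ) < duration κ q (v : ℕ)) (F K : ℕ → Fin (κ + 2)) (p : ℤ) :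
    machine b hκ J (conjugator b hκ J (insertLetter (facing J q D s (cons v F) K p,
      Fin.last (κ + 1)))) =
      conjugator b hκ J (insertLetter (machine b hκ J (facing J q D s (cons v F) K p), 0)) := by
  rw [conjugator_facing b hκ q D s v h]
  set w := Window.encode hκ ⟨q, D, s, Fin.last (κ + 1), v, h⟩ with hwdef
  have hw := Window.decode_encode hκ ⟨q, D, s, Fin.last (κ + 1), v, h⟩
  simp only [← hwdef] at hw
  have hstep := machine_window b (J := J) hκ w
  rcases lt_or_ge ((s : ℤ) + 1) (duration κ q (v : ℕ)) with hs | hs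
  · have hle := duration_le (κ := κ) (by exact_mod_cast hκ) q (v := (v : ℕ)) (by positivity)
    have hlt : (s : ℕ) + 1 < κ * (κ + 2) * κ + 1 := by zify; linarith
    have hs' : ((⟨s + 1, hlt⟩ : Fin (κ * (κ + 2) * κ + 1)) : ℤ) < duration κ q (v : ℕ) := by
      push_cast; exact hs
    rw [machine_facing_of_lt b hκ q D s ⟨s + 1, hlt⟩ v hs rfl,
      conjugator_facing b hκ q D ⟨s + 1, hlt⟩ v hs']
    rcases hstep with ⟨w', hw', hm⟩ | ⟨h1, h2⟩
    · rw [hm]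
      congr 2
      apply Window.decode_injective hκ
      rw [Window.decode_encode, hw', hw]
      simp
      ring
    · have := (w.pass hκ hw h1 h2).1
      simp at this
      nlinarith
  · have hs := le_antisymm (Int.add_one_le_iff.2 h) hs
    rcases hstep with ⟨w', hw', hm⟩ | ⟨h1, h2⟩
    · have := w'.decode_time_lt hκ
      rw [hw', hw, ← hs] at this
      simp at this
      linarith
    · obtain ⟨-, k2, k3, k4, k5⟩ := w.pass hκ hw h1 h2
      rw [Window.embed_apply, place_arrange, machine_of_eq b hκ _ _ _ _ h1, h2, k2, k4, k5, k3,
        machine_of_eq b hκ q D s v hs]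
      cases turns q (v : ℕ)
      · simp only [Bool.false_eq_true, if_false, conjugator_entry]
        cases D <;> simp [disp', disp]
      · simp only [Bool.false_eq_true, if_false, if_true, conjugator_entry]
        cases D <;> simp [disp', disp]

/-- Whether the configuration is one which the machine moves. -/
def Active (J : Type*) (ω : Config (Control κ ⊕ J) (Fin (κ + 2))) : Prop :=
  ∃ (q D : Bool) (s : Fin (κ * (κ + 2) * κ + 1)) (v : Fin (κ + 2)) (F K : ℕ → Fin (κ + 2)) (p : ℤ),
    (s : ℤ) < duration κ q (v : ℕ) ∧ ω = facing J q D s (cons v F) K p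

lemma machine_of_not_active (hκ : 2 ≤ κ) {ω : Config (Control κ ⊕ J) (Fin (κ + 2))}
    (h : ¬Active J ω) : machine b hκ J ω = ω ∧ ∀ d,
      machine b hκ J (conjugator b hκ J (insertLetter (ω, d))) =
        conjugator b hκ J (insertLetter (ω, d)) := by
  rcases config_cases ω with ⟨j, L, R, p, rfl⟩ | ⟨q, D, s, v, F, K, p, rfl⟩
  · refine ⟨?_, machine_conjugator_inr b hκ j L R p⟩
    obtain ⟨l, L, rfl⟩ := exists_cons L
    obtain ⟨r, R, rfl⟩ := exists_cons R
    exact machine_of_notMem_range b hκ (inr_notMem_range j l r) L R p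
  · have hs : ¬(s : ℤ) < duration κ q (v : ℕ) := fun hs => h ⟨q, D, s, v, F, K, p, hs, rfl⟩
    refine ⟨?_, machine_conjugator_of_notMem b hκ q D s v hs F K p⟩
    obtain ⟨u, K, rfl⟩ := exists_cons K
    rw [facing_cons, machine_of_notMem_range b hκ (arrange_notMem_range hs)]

lemma machine_pow_conjugator (hκ : 2 ≤ κ) {ω : Config (Control κ ⊕ J) (Fin (κ + 2))}
    (h : Active J ω) (d e : ℕ) (he : d + e < κ + 2) :
    (machine b hκ J ^ e) (conjugator b hκ J (insertLetter (ω, ⟨d, by omega⟩))) =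
      conjugator b hκ J (insertLetter (ω, ⟨d + e, he⟩)) := by
  induction e with
  | zero => rfl
  | succ e ih =>
    rw [pow_succ', Equiv.Perm.mul_apply, ih (by omega)]
    obtain ⟨q, D, s, v, F, K, p, hs, rfl⟩ := h
    exact machine_conjugator_succ b hκ q D s v hs F K p (d + e) (by omega)

lemma Active.machine (hκ : 2 ≤ κ) {ω : Config (Control κ ⊕ J) (Fin (κ + 2))}
    (h : Active J ω) : Active J (machine b hκ J ω) := by
  by_contra h'
  have := (machine_of_not_active b hκ h').1
  rw [EmbeddingLike.apply_eq_iff_eq] at this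
  rw [this] at h'
  exact h' h

lemma machine_pow_conjugator_zero (hκ : 2 ≤ κ) {ω : Config (Control κ ⊕ J) (Fin (κ + 2))}
    (h : Active J ω) :
    (machine b hκ J ^ (κ + 2)) (conjugator b hκ J (insertLetter (ω, 0))) =
      conjugator b hκ J (insertLetter (machine b hκ J ω, 0)) := by
  rw [pow_succ', Equiv.Perm.mul_apply]
  have := machine_pow_conjugator b hκ h 0 (κ + 1) (by omega)
  simp only [zero_add] at this
  refine (congrArg _ this).trans ?_
  obtain ⟨q, D, s, v, F, K, p, hs, rfl⟩ := h
  exact machine_conjugator_last b hκ q D s v hs F K p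

/-- The machine is an odometer over itself. -/
lemma machine_pow_eq (hκ : 2 ≤ κ) :
    machine b hκ J ^ (κ + 2) =
      conjugator b hκ J * fat (machine b hκ J) * (conjugator b hκ J)⁻¹ := by
  rw [eq_mul_inv_iff_mul_eq]
  refine ext_insertLetter fun ω d => ?_
  rw [Equiv.Perm.mul_apply, Equiv.Perm.mul_apply, fat_insertLetter]
  by_cases h : Active J ω
  · obtain ⟨d, hd⟩ := d
    have e1 := machine_pow_conjugator b hκ h 0 d (by omega)
    have e2 := machine_pow_conjugator b hκ (h.machine b hκ) 0 d (by omega)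
    simp only [zero_add] at e1 e2
    rw [← e1, ← e2, ← Equiv.Perm.mul_apply, pow_mul_comm, Equiv.Perm.mul_apply]
    exact congrArg _ (machine_pow_conjugator_zero b hκ h)
  · obtain ⟨h1, h2⟩ := machine_of_not_active b hκ h
    rw [h1]
    exact Equiv.Perm.pow_apply_eq_self_of_apply_eq_self (h2 d) _

lemma machine_pow_ne_one (hκ : 2 ≤ κ) (M : ℕ) (hM : M ≠ 0) : machine b hκ J ^ M ≠ 1 := by
  induction M using Nat.strong_induction_on with
  | _ M ih =>
    intro h1
    obtain ⟨ω, hω⟩ : ∃ ω, Active (κ := κ) J ω :=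
      ⟨_, false, false, 0, 0, fun _ => 0, fun _ => 0, 0,
        by simpa using duration_pos (κ := κ) (by exact_mod_cast hκ) _ _, rfl⟩
    set f := machine b hκ J with hf
    set ψ := conjugator b hκ J with hψ
    have hq : f ^ ((κ + 2) * (M / (κ + 2))) = ψ * fat (f ^ (M / (κ + 2))) * ψ⁻¹ := by
      rw [pow_mul, machine_pow_eq, conj_pow, map_pow]
    have hdiv := Nat.mod_add_div M (κ + 2)
    have hmod := Nat.mod_lt M (show 0 < κ + 2 by omega)
    have hact : ∀ i : ℕ, Active J ((f ^ i) ω) := by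
      intro i
      induction i with
      | zero => exact hω
      | succ i ih => rw [pow_succ', Equiv.Perm.mul_apply]; exact ih.machine b hκ
    have hr : M % (κ + 2) = 0 := by
      have e := machine_pow_conjugator b hκ (hact (M / (κ + 2))) 0 (M % (κ + 2)) (by omega)
      have e' : ψ (insertLetter (ω, 0)) = (f ^ M) (ψ (insertLetter (ω, 0))) := by rw [h1]; rfl
      rw [← hdiv, pow_add, hq, Equiv.Perm.mul_apply, Equiv.Perm.mul_apply,
        Equiv.Perm.mul_apply, Equiv.Perm.inv_def, Equiv.symm_apply_apply, fat_insertLetter] at e'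
      have := insertLetter.injective (ψ.injective (e'.trans e))
      have := congrArg Fin.val (congrArg Prod.snd this)
      simpa using this.symm
    rw [hr, zero_add] at hdiv
    rw [hdiv, h1] at hq
    have : fat (f ^ (M / (κ + 2))) = 1 := by
      have := hq.symm
      rwa [mul_inv_eq_one, mul_eq_left] at this
    have := fat_injective (this.trans (map_one fat).symm)
    refine ih (M / (κ + 2)) (Nat.div_lt_self (by omega) (by omega)) ?_ this
    rintro h0
    rw [h0] at hdiv
    omega

end CounterMachine

namespace Tape

variable {n w k : ℕ} {C B : Type*} (eC : C ≃ (Fin w → Fin n)) (eB : B ≃ (Fin 2 → Fin n))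

/-- The tape around a head at the origin; the control is stored on the `w` cells right of it, and
every letter on two cells. -/
def tape (c : C) (L R : ℕ → B) (j : ℤ) : Fin n :=
  if h0 : j < 0 then eB (L ((-1 - j).toNat / 2)) (Fin.ofNat 2 (-1 - j).toNat)
  else if h : j < w then eC c ⟨j.toNat, by omega⟩
  else eB (R ((j - w).toNat / 2)) (Fin.ofNat 2 (j - w).toNat)

lemma tape_left (c : C) (L R : ℕ → B) (t : ℕ) :
    tape eC eB c L R (-1 - t) = eB (L (t / 2)) (Fin.ofNat 2 t) := by
  rw [tape, dif_pos (by omega), show (-1 - (-1 - (t : ℤ))).toNat = t by omega]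

lemma tape_control (c : C) (L R : ℕ → B) (i : Fin w) : tape eC eB c L R (i : ℕ) = eC c i := by
  rw [tape, dif_neg (by omega), dif_pos (by omega)]
  rfl

lemma tape_right (c : C) (L R : ℕ → B) (t : ℕ) :
    tape eC eB c L R (w + t) = eB (R (t / 2)) (Fin.ofNat 2 t) := by
  rw [tape, dif_neg (by omega), dif_neg (by omega), show ((w : ℤ) + t - w).toNat = t by omega]

lemma cell_cases (w : ℕ) (j : ℤ) :
    (∃ t : ℕ, j = -1 - t) ∨ (∃ i : Fin w, j = (i : ℕ)) ∨ ∃ t : ℕ, j = w + t := by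
  rcases lt_or_ge j 0 with h | h
  · exact Or.inl ⟨(-1 - j).toNat, by omega⟩
  rcases lt_or_ge j w with h' | h'
  · exact Or.inr (Or.inl ⟨⟨j.toNat, by omega⟩, by simp only; omega⟩)
  · exact Or.inr (Or.inr ⟨(j - w).toNat, by omega⟩)

/-- The letters near the head are determined by the tape near the head. -/
lemma tape_near {c c' : C} {L L' R R' : ℕ → B}
    (h : ∀ j : ℤ, |j| ≤ w + 2 → tape eC eB c L R j = tape eC eB c' L' R' j) :
    c = c' ∧ L 0 = L' 0 ∧ R 0 = R' 0 := by
  refine ⟨eC.injective (funext fun i => ?_), eB.injective (funext fun t => ?_),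
    eB.injective (funext fun t => ?_)⟩
  · have := h (i : ℕ) (by rw [abs_le]; omega)
    rwa [tape_control, tape_control] at this
  · have := h (-1 - (t : ℕ)) (by rw [abs_le]; omega)
    rw [tape_left, tape_left] at this
    fin_cases t <;> simpa using this
  · have := h (w + (t : ℕ)) (by rw [abs_le]; omega)
    rw [tape_right, tape_right] at this
    fin_cases t <;> simpa using this

lemma tape_surjective (x : ℤ → Fin n) : ∃ c L R, tape eC eB c L R = x := by
  refine ⟨eC.symm fun i => x (i : ℕ),
    fun i => eB.symm fun t => x (-1 - (2 * i + (t : ℕ) : ℕ)),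
    fun i => eB.symm fun t => x (w + (2 * i + (t : ℕ) : ℕ)), funext fun j => ?_⟩
  rcases cell_cases w j with ⟨t, rfl⟩ | ⟨i, rfl⟩ | ⟨t, rfl⟩
  · rw [tape_left, Equiv.apply_symm_apply]
    simp only [Fin.val_ofNat, Nat.div_add_mod]
  · rw [tape_control, Equiv.apply_symm_apply]
  · rw [tape_right, Equiv.apply_symm_apply]
    simp only [Fin.val_ofNat, Nat.div_add_mod]

lemma tape_injective {c c' : C} {L L' R R' : ℕ → B}
    (h : tape eC eB c L R = tape eC eB c' L' R') : c = c' ∧ L = L' ∧ R = R' := by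
  refine ⟨eC.injective (funext fun i => ?_), funext fun i => eB.injective (funext fun t => ?_),
    funext fun i => eB.injective (funext fun t => ?_)⟩
  · have := congrFun h (i : ℕ)
    rwa [tape_control, tape_control] at this
  · have := congrFun h (-1 - (2 * i + (t : ℕ) : ℕ))
    rw [tape_left, tape_left] at this
    rwa [show (2 * i + (t : ℕ)) / 2 = i by omega,
      show Fin.ofNat 2 (2 * i + t) = t from Fin.ext (by simp [Fin.ofNat]; omega)] at this
  · have := congrFun h (w + (2 * i + (t : ℕ) : ℕ))
    rw [tape_right, tape_right] at this
    rwa [show (2 * i + (t : ℕ)) / 2 = i by omega,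
      show Fin.ofNat 2 (2 * i + t) = t from Fin.ext (by simp [Fin.ofNat]; omega)] at this

/-- A permutation is local if it rewrites the tape near the head, and moves the head, in a way
that only depends on the control and the letters next to the head. -/
def IsLocal (σ : Equiv.Perm (Config C B)) : Prop :=
  ∃ (G : C × B × B → ℤ → Option (Fin n)) (δ : C × B × B → ℤ) (N : ℕ),
    (∀ z j, (N : ℤ) < |j| → G z j = none) ∧ (∀ z, |δ z| ≤ N) ∧
    ∀ c L R p, (σ (c, L, R, p)).2.2.2 = p + δ (c, L 0, R 0) ∧
      ∀ j, tape eC eB (σ (c, L, R, p)).1 (σ (c, L, R, p)).2.1 (σ (c, L, R, p)).2.2.1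
        (j - δ (c, L 0, R 0)) = (G (c, L 0, R 0) j).getD (tape eC eB c L R j)

lemma isLocal_loc (τ : Equiv.Perm (C × B × B)) : IsLocal eC eB (loc τ) := by
  refine ⟨fun z j => if -2 ≤ j ∧ j < w + 2 then
      some (tape eC eB (τ z).1 (fun _ => (τ z).2.1) (fun _ => (τ z).2.2) j) else none,
    fun _ => 0, w + 2, fun z j hj => if_neg ?_, by simp; omega, fun c L R p => ⟨by simp [loc], ?_⟩⟩
  · rw [lt_abs] at hj; omega
  intro j
  obtain ⟨l, L, rfl⟩ := exists_cons L
  obtain ⟨r, R, rfl⟩ := exists_cons R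
  simp only [loc_apply, cons_zero, sub_zero]
  rcases cell_cases w j with ⟨t, rfl⟩ | ⟨i, rfl⟩ | ⟨t, rfl⟩
  · simp only [tape_left]
    rcases lt_or_ge t 2 with h | h
    · rw [if_pos (by omega), Nat.div_eq_of_lt h]; rfl
    · rw [if_neg (by omega)]
      obtain ⟨t, rfl⟩ := Nat.exists_eq_add_of_le' h
      simp
  · simp only [tape_control]
    rw [if_pos (by omega)]; rfl
  · simp only [tape_right]
    rcases lt_or_ge t 2 with h | h
    · rw [if_pos (by omega), Nat.div_eq_of_lt h]; rfl
    · rw [if_neg (by omega)]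
      obtain ⟨t, rfl⟩ := Nat.exists_eq_add_of_le' h
      simp

lemma ofNat_add_two (t : ℕ) : Fin.ofNat 2 (t + 2) = Fin.ofNat 2 t := Fin.ext (by simp [Fin.ofNat])

lemma isLocal_move (φ : C → Bool) : IsLocal eC eB (move 2 φ) := by
  refine ⟨fun z j => if φ z.1 ∧ 0 ≤ j ∧ j < w + 2 then
      some (tape eC eB z.1 (fun _ => z.2.2) (fun _ => z.2.2) (j - 2)) else none,
    fun z => if φ z.1 then 2 else 0, w + 2, fun z j hj => if_neg ?_, ?_, fun c L R p => ?_⟩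
  · rw [lt_abs] at hj; omega
  · intro z
    dsimp only
    split_ifs <;> simp
    omega
  obtain ⟨r, R, rfl⟩ := exists_cons R
  cases h : φ c
  · simp [move_apply_false 2 h, h]
  · simp only [move_apply_true 2 h, h, cons_zero, if_true, true_and]
    intro j
    rcases cell_cases w (j - 2) with ⟨t, ht⟩ | ⟨i, hi⟩ | ⟨t, ht⟩
    · rw [ht]
      simp only [tape_left]
      rcases lt_or_ge t 2 with h | h
      · rw [if_pos (by omega), Nat.div_eq_of_lt h]; rfl
      · rw [if_neg (by omega)]
        obtain ⟨t, rfl⟩ := Nat.exists_eq_add_of_le' h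
        obtain rfl : j = -1 - t := by push_cast at ht; omega
        rw [tape_left, ofNat_add_two]
        simp
    · rw [hi, if_pos (by omega)]
      simp [tape_control]
    · rw [ht, if_neg (by omega)]
      obtain rfl : j = w + (t + 2 : ℕ) := by push_cast; omega
      rw [tape_right, Option.getD_none, tape_right, ofNat_add_two]
      simp

end Tape

namespace Tape

variable {n w k : ℕ} {C B : Type*} (eC : C ≃ (Fin w → Fin n)) (eB : B ≃ (Fin 2 → Fin n))

/-- The point of `RTMSpace n k` representing a configuration; the head is in the state `k`. -/
def toRTM (k : ℕ) (ω : Config C B) : RTMSpace n k :=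
  ⟨(fun i => tape eC eB ω.1 ω.2.1 ω.2.2.1 (i - ω.2.2.2),
    fun i => if i = ω.2.2.2 then Fin.last k else 0), by
    intro i j hi hj
    simp only [ne_eq, ite_eq_right_iff, Classical.not_imp] at hi hj
    rw [hi.1, hj.1]⟩

lemma toRTM_fst (c : C) (L R : ℕ → B) (p i : ℤ) :
    (toRTM eC eB k (c, L, R, p)).1.1 i = tape eC eB c L R (i - p) := rfl

lemma toRTM_snd (c : C) (L R : ℕ → B) (p i : ℤ) :
    (toRTM eC eB k (c, L, R, p)).1.2 i = if i = p then Fin.last k else 0 := rfl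

lemma last_ne_zero (hk : 1 ≤ k) : Fin.last k ≠ 0 := Fin.ne_of_val_ne (by simp; omega)

lemma toRTM_injective (hk : 1 ≤ k) : Function.Injective (toRTM eC eB k) := by
  rintro ⟨c, L, R, p⟩ ⟨c', L', R', p'⟩ h
  have h1 := congrArg (fun x : RTMSpace n k => x.1.1) h
  have h2 := congrFun (congrArg (fun x : RTMSpace n k => x.1.2) h) p
  simp only [toRTM, if_true] at h1 h2
  obtain rfl : p = p' := by
    by_contra hp
    rw [if_neg hp] at h2
    exact last_ne_zero hk h2
  obtain ⟨rfl, rfl, rfl⟩ := tape_injective eC eB (c := c) (c' := c') (L := L) (L' := L') (R := R)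
    (R' := R') (funext fun j => by simpa using congrFun h1 (j + p))
  rfl

lemma exists_toRTM (hk : 1 ≤ k) {x : RTMSpace n k} {p : ℤ} (h : x.1.2 p = Fin.last k) :
    ∃ c L R, x = toRTM eC eB k (c, L, R, p) := by
  obtain ⟨c, L, R, e⟩ := tape_surjective eC eB fun j => x.1.1 (j + p)
  refine ⟨c, L, R, Subtype.ext (Prod.ext (funext fun i => ?_) (funext fun i => ?_))⟩
  · simp [toRTM_fst, e]
  · rw [toRTM_snd]
    split_ifs with hi
    · rw [hi, h]
    · by_contra h'
      exact hi (x.2 i p h' (h ▸ last_ne_zero hk))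

/-- The embedding of configurations into `RTMSpace n k`. -/
def embedRTM (hk : 1 ≤ k) : Config C B ↪ RTMSpace n k := ⟨toRTM eC eB k, toRTM_injective eC eB hk⟩

lemma mem_range_embedRTM (hk : 1 ≤ k) {x : RTMSpace n k} :
    x ∈ Set.range (embedRTM eC eB hk) ↔ ∃ p, x.1.2 p = Fin.last k := by
  constructor
  · rintro ⟨⟨c, L, R, p⟩, rfl⟩
    exact ⟨p, if_pos rfl⟩
  · rintro ⟨p, hp⟩
    obtain ⟨c, L, R, rfl⟩ := exists_toRTM eC eB hk hp
    exact ⟨_, rfl⟩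

instance : CompactSpace (RTMSpace n k) := by
  refine isCompact_iff_compactSpace.1 (IsClosed.isCompact ?_)
  have : RTMSpace n k = ⋂ (i : ℤ) (j : ℤ), {x | x.2 i ≠ 0 → x.2 j ≠ 0 → i = j} := by
    ext x; simp [RTMSpace]
  rw [this]
  refine isClosed_iInter fun i => isClosed_iInter fun j => ?_
  exact (isClosed_discrete {y : Fin (k + 1) × Fin (k + 1) | y.1 ≠ 0 → y.2 ≠ 0 → i = j}).preimage
    (f := fun x : RTMConf n k => (x.2 i, x.2 j)) (by fun_prop)

/-- A map with a sliding window is continuous. -/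
lemma continuous_of_window {g : RTMSpace n k → RTMSpace n k} (N : ℤ)
    (h : ∀ x y : RTMSpace n k, ∀ i : ℤ,
      (∀ j, |j - i| ≤ N → x.1.1 j = y.1.1 j ∧ x.1.2 j = y.1.2 j) →
      (g x).1.1 i = (g y).1.1 i ∧ (g x).1.2 i = (g y).1.2 i) : Continuous g := by
  have key (x : RTMSpace n k) (i : ℤ) : ∀ᶠ y in nhds x,
      (g y).1.1 i = (g x).1.1 i ∧ (g y).1.2 i = (g x).1.2 i := by
    have hw : ∀ᶠ y in nhds x, ∀ j ∈ Finset.Icc (i - N) (i + N),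
        y.1.1 j = x.1.1 j ∧ y.1.2 j = x.1.2 j := by
      rw [Filter.eventually_all_finset]
      intro j _
      have h1 : Continuous fun y : RTMSpace n k => (y.1.1 j, y.1.2 j) := by fun_prop
      exact ((IsLocallyConstant.iff_eventually_eq _).1
        ((IsLocallyConstant.iff_continuous _).2 h1) x).mono
        fun y hy => Prod.ext_iff.1 hy
    filter_upwards [hw] with y hy
    exact h y x i fun j hj => hy j (by rw [abs_le] at hj; rw [Finset.mem_Icc]; omega)
  refine Continuous.subtype_mk (f := fun x => (g x).1) (Continuous.prodMk
    (continuous_pi fun i => ?_) (continuous_pi fun i => ?_)) _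
  · exact ((IsLocallyConstant.iff_eventually_eq _).2 fun x =>
      (key x i).mono fun _ h => h.1).continuous
  · exact ((IsLocallyConstant.iff_eventually_eq _).2 fun x =>
      (key x i).mono fun _ h => h.2).continuous

lemma viaEmbedding_mem_RTMGroup (hk : 1 ≤ k) {σ : Equiv.Perm (Config C B)}
    (hσ : IsLocal eC eB σ) : Equiv.Perm.viaEmbedding σ (embedRTM eC eB hk) ∈ RTMGroup n k := by
  obtain ⟨G, δ, N, hG, hδ, hσ⟩ := hσ
  set g := Equiv.Perm.viaEmbedding σ (embedRTM eC eB hk) with hg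
  have hg1 (c L R p) : ∀ i, (g (toRTM eC eB k (c, L, R, p))).1.1 i =
      (G (c, L 0, R 0) (i - p)).getD (tape eC eB c L R (i - p)) := by
    intro i
    have e : g (toRTM eC eB k (c, L, R, p)) = toRTM eC eB k (σ (c, L, R, p)) :=
      Equiv.Perm.viaEmbedding_apply σ (embedRTM eC eB hk) _
    rw [e, ← (hσ c L R p).2 (i - p), sub_sub, ← (hσ c L R p).1]
    rfl
  have hg2 (c L R p) : ∀ i, (g (toRTM eC eB k (c, L, R, p))).1.2 i =
      if i = p + δ (c, L 0, R 0) then Fin.last k else 0 := by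
    intro i
    have e : g (toRTM eC eB k (c, L, R, p)) = toRTM eC eB k (σ (c, L, R, p)) :=
      Equiv.Perm.viaEmbedding_apply σ (embedRTM eC eB hk) _
    rw [e, ← (hσ c L R p).1]
    rfl
  have hg0 {x : RTMSpace n k} (hx : ¬∃ p, x.1.2 p = Fin.last k) : g x = x :=
    Equiv.Perm.viaEmbedding_apply_of_notMem _ _ _ (by rwa [mem_range_embedRTM])
  have hfar {x : RTMSpace n k} {i : ℤ} (hx : ∀ p, |p - i| ≤ N → x.1.2 p ≠ Fin.last k) :
      (g x).1.1 i = x.1.1 i ∧ (g x).1.2 i = x.1.2 i := by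
    by_cases hp : ∃ p, x.1.2 p = Fin.last k
    · obtain ⟨p, hp⟩ := hp
      have hpi : N < |i - p| := by
        rw [abs_sub_comm]
        exact lt_of_not_ge fun h => hx p h hp
      obtain ⟨c, L, R, rfl⟩ := exists_toRTM eC eB hk hp
      rw [hg1, hg2, hG _ _ hpi]
      have := hδ (c, L 0, R 0)
      refine ⟨rfl, ?_⟩
      rw [toRTM_snd, if_neg, if_neg]
      · rintro rfl
        simp at hpi
        exact absurd (abs_nonneg (δ (c, L 0, R 0))) (by linarith)
      · rintro rfl
        simp at hpi
        linarith
    · rw [hg0 hp]; exact ⟨rfl, rfl⟩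
  have hcont : Continuous g := by
    refine continuous_of_window (N + (w + 2)) fun x y i hxy => ?_
    by_cases hp : ∃ p, |p - i| ≤ N ∧ x.1.2 p = Fin.last k
    · obtain ⟨p, hpi, hp⟩ := hp
      have hp' : y.1.2 p = Fin.last k := by rw [← (hxy p (by linarith)).2, hp]
      obtain ⟨c, L, R, rfl⟩ := exists_toRTM eC eB hk hp
      obtain ⟨c', L', R', rfl⟩ := exists_toRTM eC eB hk hp'
      obtain ⟨e1, e2, e3⟩ := tape_near eC eB (c := c) (c' := c') (L := L) (L' := L') (R := R)
        (R' := R') fun j hj => by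
          have := (hxy (j + p) (by
            have := abs_add_le j (p - i)
            rw [add_sub_assoc]
            linarith)).1
          simpa [toRTM_fst] using this
      rw [hg1, hg1, hg2, hg2, e1, e2, e3]
      refine ⟨?_, rfl⟩
      have := (hxy i (by simp; linarith [abs_nonneg (p - i)])).1
      rw [toRTM_fst, toRTM_fst] at this
      rw [← e1, this, e1]
    · push Not at hp
      have hp' : ∀ p, |p - i| ≤ N → y.1.2 p ≠ Fin.last k := fun p h =>
        (hxy p (by linarith)).2 ▸ hp p h
      rw [(hfar hp).1, (hfar hp).2, (hfar hp').1, (hfar hp').2]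
      exact hxy i (by simp; omega)
  refine ⟨hcont, (hcont.homeoOfEquivCompactToT2 (f := g)).symm.continuous, ?_, ?_⟩
  · intro x y hxy
    have h1 : ∀ i, y.1.1 i = x.1.1 (i + 1) := fun i => congrFun (congrArg Prod.fst hxy) i
    have h2 : ∀ i, y.1.2 i = x.1.2 (i + 1) := fun i => congrFun (congrArg Prod.snd hxy) i
    by_cases hp : ∃ p, x.1.2 p = Fin.last k
    · obtain ⟨p, hp⟩ := hp
      obtain ⟨c, L, R, rfl⟩ := exists_toRTM eC eB hk hp
      obtain rfl : y = toRTM eC eB k (c, L, R, p - 1) := by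
        refine Subtype.ext (Prod.ext (funext fun i => ?_) (funext fun i => ?_))
        · rw [h1, toRTM_fst, toRTM_fst]; congr 1; ring
        · simp only [h2, toRTM_snd, eq_sub_iff_add_eq]
      refine Prod.ext (funext fun i => ?_) (funext fun i => ?_)
      · simp only [RTMshift]
        rw [hg1, hg1, show i - (p - 1) = i + 1 - p by ring]
      · simp only [RTMshift]
        rw [hg2, hg2]
        congr 1
        simp only [eq_iff_iff]
        omega
    · rw [hg0 hp, hg0, hxy]
      rintro ⟨p, hp'⟩
      exact hp ⟨p + 1, by rw [← h2, hp']⟩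
  · intro x hx
    refine hg0 ?_
    rintro ⟨p, hp⟩
    rw [hx] at hp
    exact last_ne_zero hk hp.symm

end Tape

open Tape CounterMachine in
lemma exists_infinite_order_hasWord (n k : ℕ) (hn : 2 ≤ n) (hk : 1 ≤ k) :
    ∃ F : Finset (Equiv.Perm (RTMSpace n k)), ↑F ⊆ RTMGroup n k ∧
      ∃ f, (∀ m : ℕ, m ≠ 0 → f ^ m ≠ 1) ∧ ∃ A : ℕ, ∀ K M : ℕ, M < 2 ^ K →
        HasWord (F : Set (Equiv.Perm (RTMSpace n k))) (K * (A * (K + 1))) (f ^ M) := by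
  have hn4 : 2 * 2 ≤ n * n := Nat.mul_le_mul hn hn
  obtain ⟨κ, hκn⟩ : ∃ κ, n ^ 2 = κ + 2 := ⟨n ^ 2 - 2, by rw [sq]; omega⟩
  have hκ : 2 ≤ κ := by rw [sq] at hκn; omega
  set w := Fintype.card (Control κ) with hw
  let J := Fin (n ^ w - w)
  have eB : Fin (κ + 2) ≃ (Fin 2 → Fin n) := Fintype.equivOfCardEq (by simp [hκn])
  have eC : Control κ ⊕ J ≃ (Fin w → Fin n) := Fintype.equivOfCardEq (by
    have := (Nat.lt_pow_self (show 1 < n by omega) : w < n ^ w).le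
    rw [Fintype.card_sum, ← hw]
    simp only [J, Fintype.card_fin, Fintype.card_fun]
    omega)
  let Φ := Equiv.Perm.viaEmbeddingHom (embedRTM eC eB hk)
  have hfin : (gens (Control κ ⊕ J) (Fin (κ + 2)) 2).Finite :=
    (Set.finite_range _).union (Set.finite_range _)
  refine ⟨(hfin.image Φ).toFinset, ?_, Φ (machine 2 hκ J), ?_, (κ + 2 + 2) * (4 * 10), ?_⟩
  · rw [Set.Finite.coe_toFinset]
    rintro _ ⟨_, ⟨τ, rfl⟩ | ⟨φ, rfl⟩, rfl⟩
    · exact viaEmbedding_mem_RTMGroup eC eB hk (isLocal_loc eC eB τ)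
    · exact viaEmbedding_mem_RTMGroup eC eB hk (isLocal_move eC eB φ)
  · intro m hm h
    rw [← map_pow] at h
    exact machine_pow_ne_one 2 hκ m hm
      (Equiv.Perm.viaEmbeddingHom_injective (embedRTM eC eB hk) (h.trans (map_one Φ).symm))
  · intro K M hM
    rw [Set.Finite.coe_toFinset, ← map_pow]
    have := hasWord_fat_iterate_pow 2 (by omega) (hasWord_machine (J := J) 2 hκ)
      (hasWord_conjugator (J := J) 2 hκ) (machine_pow_eq 2 hκ) K 0 M
      (hM.trans_le (Nat.pow_le_pow_left (by omega) K))
    refine (this.map Φ).mono (le_of_eq ?_)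
    ring

/-- The group of Turing machines as a subgroup. -/
def rtmSubgroup (n k : ℕ) : Subgroup (Equiv.Perm (RTMSpace n k)) where
  carrier := RTMGroup n k
  one_mem' := ⟨continuous_id, continuous_id, fun _ _ h => h, fun _ _ => rfl⟩
  mul_mem' {f g} hf hg := by
    refine ⟨hf.1.comp hg.1, hg.2.1.comp hf.2.1, fun p q h => hf.2.2.1 _ _ (hg.2.2.1 _ _ h), ?_⟩
    intro p hp
    rw [Equiv.Perm.mul_apply, hg.2.2.2 p hp, hf.2.2.2 p hp]
  inv_mem' {f} hf := by
    refine ⟨hf.2.1, hf.1, fun p q h => ?_, fun p hp => ?_⟩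
    · have hs : RTMshift n k (f⁻¹ p : RTMSpace n k).1 ∈ RTMSpace n k := fun i j hi hj =>
        add_right_cancel ((f⁻¹ p).2 (i + 1) (j + 1) hi hj)
      have := hf.2.2.1 (f⁻¹ p) ⟨_, hs⟩ rfl
      rw [show f (f⁻¹ p) = p from f.apply_symm_apply p, ← h] at this
      rw [← Subtype.ext this]
      exact congrArg Subtype.val (f.symm_apply_apply ⟨_, hs⟩)
    · rw [Equiv.Perm.inv_eq_iff_eq, hf.2.2.2 p hp]

/-- **Theorem.** For `n ≥ 2`, `k ≥ 1`, the group of Turing machines `RTM(n,k)` contains a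
distortion element: a finite `F ⊆ RTM(n,k)` and `f ∈ ⟨F⟩ ∩ RTM(n,k)` of infinite order with
`‖f^m‖_F ≤ K·(log₂ m)⁴` for all `m ≥ 2`. -/
theorem rtm_distortion (n k : ℕ) (hn : 2 ≤ n) (hk : 1 ≤ k) :
    ∃ F : Finset (Equiv.Perm (RTMSpace n k)), ↑F ⊆ RTMGroup n k ∧
      ∃ f ∈ Subgroup.closure (F : Set (Equiv.Perm (RTMSpace n k))),
        f ∈ RTMGroup n k ∧ (∀ m : ℕ, 1 ≤ m → f ^ m ≠ 1) ∧
        ∃ K : ℝ, 0 < K ∧ ∀ m : ℕ, 2 ≤ m →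
          (wordNorm (F : Set (Equiv.Perm (RTMSpace n k))) (f ^ m) : ℝ) ≤
            K * (Real.logb 2 m) ^ 4 := by
  obtain ⟨F, hF, f, hf, A, hA⟩ := exists_infinite_order_hasWord n k hn hk
  have hmem : f ∈ Subgroup.closure (F : Set (Equiv.Perm (RTMSpace n k))) := by
    simpa using (hA 1 1 (by norm_num)).mem_closure
  refine ⟨F, hF, f, hmem, ?_, fun m hm => hf m (by omega), 6 * (A + 1), by positivity,
    fun m hm => ?_⟩
  · exact (Subgroup.closure_le (rtmSubgroup n k)).2 hF hmem
  · have h1 := (hA (Nat.log 2 m + 1) m (Nat.lt_pow_succ_log_self (by norm_num) m)).wordNorm_le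
    have h2 : (Nat.log 2 m : ℝ) ≤ Real.logb 2 m := by exact_mod_cast Real.natLog_le_logb m 2
    have h3 : 1 ≤ Real.logb 2 m := by
      rw [Real.le_logb_iff_rpow_le (by norm_num) (by positivity)]
      simpa using (show (2 : ℝ) ≤ m by exact_mod_cast hm)
    set l := Real.logb 2 m
    calc (wordNorm (F : Set (Equiv.Perm (RTMSpace n k))) (f ^ m) : ℝ)
        ≤ (Nat.log 2 m + 1) * (A * (Nat.log 2 m + 1 + 1)) := by exact_mod_cast h1
      _ ≤ (l + l) * ((A + 1) * (l + l + l)) := by gcongr; all_goals linarith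
      _ = 6 * (A + 1) * l ^ 2 := by ring
      _ ≤ 6 * (A + 1) * l ^ 4 := by gcongr; norm_num
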